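/- If a > max(a*_K, 1), then there is exactly one ρ_a ∈ (1, 2) with φ_K(a, ρ_a) = 0; moreover φ_K(a, 2-ρ_a) = 0, both ρ_a and 2-ρ_a are simple zeros (the s-derivative of φ_K(a,·) is nonzero there), and every zero s ∉ {0, 1, 2} of φ_K(a,·) with Re(s) ≠ 1 belongs to {ρ_a, 2-ρ_a}. -/

import Mathlib

open Complex Filter NumberField

/-- The Dedekind zeta function of a number field `K`, given (for `Re(s) > 1`) as the
sum of `N(I)^{-s}` over the nonzero ideals `I` of the ring of integers of `K`. -/
noncomputable def dedekindZetaSum (K : Type*) [Field K] [NumberField K] (s : ℂ) : ℂ :=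
  ∑' I : {I : Ideal (𝓞 K) // I ≠ ⊥}, (Ideal.absNorm I.1 : ℂ) ^ (-s)

/-- `ΛK` is the completed Dedekind zeta function of `K`:
`Λ_K(s) = (√|d_K|/(2π))^s Γ(s) ζ_K(s)` for `Re(s) > 1`, holomorphic away from
(simple) poles at `s = 0` and `s = 1`, and satisfying `Λ_K(s) = Λ_K(1-s)`. -/
structure IsCompletedDedekindZeta (K : Type*) [Field K] [NumberField K]
    (ΛK : ℂ → ℂ) : Prop where
  eq_on_gt_one : ∀ s : ℂ, 1 < s.re → ΛK s =
    ((Real.sqrt |(NumberField.discr K : ℝ)| / (2 * Real.pi) : ℝ) : ℂ) ^ s *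
      Complex.Gamma s * dedekindZetaSum K s
  differentiableOn : DifferentiableOn ℂ ΛK {(0 : ℂ), 1}ᶜ
  functional_equation : ∀ s : ℂ, ΛK s = ΛK (1 - s)
  simple_pole_at_one : ∃ r : ℂ, r ≠ 0 ∧
    Tendsto (fun s : ℂ => (s - 1) * ΛK s) (nhdsWithin 1 {(1 : ℂ)}ᶜ) (nhds r)

/-- The constant term `φ_K(a,s) = a^s Λ_K(s) + a^{2-s} Λ_K(s-1)` of the Eisenstein
series attached to `PSL(2, 𝓞_K)`. -/
noncomputable def phiK (ΛK : ℂ → ℂ) (a : ℝ) (s : ℂ) : ℂ :=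
  (a : ℂ) ^ s * ΛK s + (a : ℂ) ^ (2 - s) * ΛK (s - 1)

open HurwitzZeta Topology in
lemma abs_evenKernel_sub_le (a : ℝ) {t : ℝ} (ht : 0 < t) :
    |evenKernel a t - (√t)⁻¹| ≤ evenKernel 0 t - (√t)⁻¹ := by
  have hu : 0 < 1 / t := by positivity
  have key : |cosKernel a (1 / t) - 1| ≤ cosKernel 0 (1 / t) - 1 := by
    have h1 := hasSum_int_cosKernel₀ a hu
    have h0 : HasSum (fun n : ℤ ↦ if n = 0 then (0 : ℝ) else Real.exp (-Real.pi * n ^ 2 * (1 / t)))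
        (cosKernel 0 (1 / t) - 1) := by
      have := hasSum_int_cosKernel₀ 0 hu
      rw [← Complex.hasSum_ofReal]
      convert this using 2 with n
      · split_ifs <;> simp
      · simp
    have := tsum_of_norm_bounded h0 (f := fun n : ℤ ↦ if n = 0 then 0 else
      cexp (2 * Real.pi * I * a * n) * Real.exp (-Real.pi * n ^ 2 * (1 / t))) (fun n ↦ by
        split_ifs
        · simp
        · rw [norm_mul, show (2 * Real.pi * I * a * n : ℂ) = ((2 * Real.pi * a * n : ℝ) : ℂ) * I by
            push_cast; ring, Complex.norm_exp_ofReal_mul_I, one_mul, Complex.norm_real,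
            Real.norm_of_nonneg (Real.exp_pos _).le])
    rw [h1.tsum_eq] at this
    rwa [← Complex.ofReal_one, ← Complex.ofReal_sub, Complex.norm_real, Real.norm_eq_abs] at this
  have e (b : UnitAddCircle) : evenKernel b t - (√t)⁻¹ = (√t)⁻¹ * (cosKernel b (1 / t) - 1) := by
    rw [evenKernel_functional_equation, ← Real.sqrt_eq_rpow]; ring
  rw [e, e, abs_mul, abs_of_nonneg (by positivity)]
  gcongr

open HurwitzZeta Topology in
lemma eventually_evenKernel_zero_le :
    ∀ᶠ t : ℝ in 𝓝[>] 0, evenKernel 0 t - (√t)⁻¹ ≤ t := by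
  obtain ⟨p, hp, hO⟩ := isBigO_atTop_cosKernel_sub 0
  have h2 : (fun x : ℝ ↦ cosKernel 0 x - 1) =o[atTop] fun x : ℝ ↦ x ^ (-2 : ℝ) :=
    hO.trans_isLittleO (by simpa using isLittleO_exp_neg_mul_rpow_atTop hp (-2))
  have h3 := tendsto_inv_nhdsGT_zero.eventually (h2.def one_pos)
  filter_upwards [h3, self_mem_nhdsWithin, Ioc_mem_nhdsGT one_pos] with t h3 ht0 ht1
  have ht0 : 0 < t := ht0
  rw [evenKernel_functional_equation, ← Real.sqrt_eq_rpow]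
  have h4 : cosKernel 0 (1 / t) - 1 ≤ t ^ 2 := by
    have := (le_abs_self _).trans (h3.trans (le_of_eq (by rw [one_mul])))
    rw [Real.norm_of_nonneg (by positivity), Real.rpow_neg (by positivity), Real.inv_rpow ht0.le,
      inv_inv] at this
    rw [one_div]; exact_mod_cast this
  have h5 : 0 < √t := Real.sqrt_pos.mpr ht0
  have h6 : √t * √t = t := Real.mul_self_sqrt ht0.le
  have h7 : √t ≤ 1 := Real.sqrt_le_one.mpr ht1.2
  calc 1 / √t * cosKernel 0 (1 / t) - (√t)⁻¹ = (√t)⁻¹ * (cosKernel 0 (1 / t) - 1) := by ring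
    _ ≤ (√t)⁻¹ * t ^ 2 := by gcongr
    _ = √t * t := by
      rw [inv_mul_eq_iff_eq_mul₀ h5.ne', ← mul_assoc, h6]; ring
    _ ≤ 1 * t := by gcongr
    _ = t := one_mul t

open HurwitzZeta Topology in
/-- The theta series of a binary quadratic form `(m + n x)² + (n y)²`, with its behaviour at `0`. -/
lemma theta_form (x : ℝ) {y : ℝ} (hy : y ≠ 0) :
    (∀ t : ℝ, 0 < t → Summable fun p : ℤ × ℤ ↦
      Real.exp (-Real.pi * ((p.2 + p.1 * x) ^ 2 + (p.1 * y) ^ 2) * t)) ∧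
    ∃ C : ℝ, ∀ᶠ t : ℝ in 𝓝[>] 0, |∑' p : ℤ × ℤ,
      Real.exp (-Real.pi * ((p.2 + p.1 * x) ^ 2 + (p.1 * y) ^ 2) * t) - |y|⁻¹ / t| ≤ C := by
  have hy2 : 0 < y ^ 2 := by positivity
  have e0 (t : ℝ) (n m : ℤ) : Real.exp (-Real.pi * ((m + n * x) ^ 2 + (n * y) ^ 2) * t) =
      Real.exp (-Real.pi * (n + (0 : ℝ)) ^ 2 * (y ^ 2 * t)) *
        Real.exp (-Real.pi * (m + n * x) ^ 2 * t) := by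
    rw [← Real.exp_add]; ring_nf
  have hin {t : ℝ} (ht : 0 < t) (n : ℤ) : HasSum (fun m : ℤ ↦
      Real.exp (-Real.pi * ((m + n * x) ^ 2 + (n * y) ^ 2) * t))
      (Real.exp (-Real.pi * (n + (0 : ℝ)) ^ 2 * (y ^ 2 * t)) *
        evenKernel ((n * x : ℝ) : UnitAddCircle) t) := by
    simp_rw [e0]
    exact (hasSum_int_evenKernel (n * x) ht).mul_left _
  have hw {t : ℝ} (ht : 0 < t) : HasSum (fun n : ℤ ↦
      Real.exp (-Real.pi * (n + (0 : ℝ)) ^ 2 * (y ^ 2 * t))) (evenKernel 0 (y ^ 2 * t)) :=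
    hasSum_int_evenKernel 0 (mul_pos hy2 ht)
  have hE {t : ℝ} (ht : 0 < t) (n : ℤ) :
      |evenKernel ((n * x : ℝ) : UnitAddCircle) t - (√t)⁻¹| ≤ evenKernel 0 t - (√t)⁻¹ :=
    abs_evenKernel_sub_le _ ht
  have hE0 {t : ℝ} (ht : 0 < t) (n : ℤ) : 0 ≤ evenKernel ((n * x : ℝ) : UnitAddCircle) t :=
    (hasSum_int_evenKernel (n * x) ht).nonneg fun _ ↦ (Real.exp_pos _).le
  have hsum {t : ℝ} (ht : 0 < t) : Summable fun p : ℤ × ℤ ↦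
      Real.exp (-Real.pi * ((p.2 + p.1 * x) ^ 2 + (p.1 * y) ^ 2) * t) := by
    rw [summable_prod_of_nonneg fun _ ↦ (Real.exp_pos _).le]
    refine ⟨fun n ↦ (hin ht n).summable, ?_⟩
    simp_rw [fun n ↦ (hin ht n).tsum_eq]
    refine Summable.of_nonneg_of_le (fun n ↦ mul_nonneg (Real.exp_pos _).le (hE0 ht n))
      (fun n ↦ ?_) ((hw ht).summable.mul_right (evenKernel 0 t))
    gcongr
    linarith [le_abs_self _ |>.trans (hE ht n)]
  refine ⟨fun t ht ↦ hsum ht, (|y|⁻¹ + y ^ 2) + y ^ 2, ?_⟩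
  have hlim : Tendsto (fun t : ℝ ↦ y ^ 2 * t) (𝓝[>] 0) (𝓝[>] 0) := by
    refine tendsto_nhdsWithin_iff.mpr ⟨?_, ?_⟩
    · exact ((continuous_const_mul (y ^ 2)).tendsto' 0 0 (mul_zero _)).mono_left nhdsWithin_le_nhds
    · filter_upwards [self_mem_nhdsWithin] with t ht
      exact mul_pos hy2 ht
  filter_upwards [eventually_evenKernel_zero_le, hlim.eventually eventually_evenKernel_zero_le,
    self_mem_nhdsWithin, Ioc_mem_nhdsGT one_pos] with t h1 h2 ht0 ht1
  have ht : 0 < t := ht0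
  have ht1 : t ≤ 1 := ht1.2
  have hsq : 0 < √t := Real.sqrt_pos.mpr ht
  have hsqt : √t * √t = t := Real.mul_self_sqrt ht.le
  have hsq1 : √t ≤ 1 := Real.sqrt_le_one.mpr ht1
  have hy' : 0 < |y| := abs_pos.mpr hy
  have hsy : √(y ^ 2 * t) = |y| * √t := by rw [Real.sqrt_mul hy2.le, Real.sqrt_sq_eq_abs]
  set c := (√t)⁻¹ with hc
  set W := evenKernel 0 (y ^ 2 * t) with hW
  have hcpos : 0 < c := by positivity
  have hWpos : 0 ≤ W := (hw ht).nonneg fun _ ↦ (Real.exp_pos _).le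
  have hct : c * t = √t := by
    rw [hc, inv_mul_eq_iff_eq_mul₀ hsq.ne', hsqt]
  have hcc : |y|⁻¹ / t = c * (|y|⁻¹ * c) := by
    rw [hc]; nth_rw 1 [← hsqt]; rw [div_eq_mul_inv, mul_inv]; ring
  have hW2 : |W - |y|⁻¹ * c| ≤ y ^ 2 * t := by
    have h3 := abs_evenKernel_sub_le 0 (mul_pos hy2 ht)
    rw [hsy, mul_inv] at h2 h3
    exact h3.trans h2
  have htot : ∑' p : ℤ × ℤ, Real.exp (-Real.pi * ((p.2 + p.1 * x) ^ 2 + (p.1 * y) ^ 2) * t) =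
      ∑' n : ℤ, Real.exp (-Real.pi * (n + (0 : ℝ)) ^ 2 * (y ^ 2 * t)) *
        evenKernel ((n * x : ℝ) : UnitAddCircle) t := by
    rw [(hsum ht).tsum_prod]
    exact tsum_congr fun n ↦ (hin ht n).tsum_eq
  have hdiff : |∑' p : ℤ × ℤ, Real.exp (-Real.pi * ((p.2 + p.1 * x) ^ 2 + (p.1 * y) ^ 2) * t)
      - W * c| ≤ W * t := by
    have hs : Summable fun n : ℤ ↦ Real.exp (-Real.pi * (n + (0 : ℝ)) ^ 2 * (y ^ 2 * t)) *
        evenKernel ((n * x : ℝ) : UnitAddCircle) t := by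
      have := (hsum ht).prod
      simpa only [fun n ↦ (hin ht n).tsum_eq] using this
    have h4 := hs.hasSum.sub ((hw ht).mul_right c)
    rw [htot, ← h4.tsum_eq, ← Real.norm_eq_abs]
    refine tsum_of_norm_bounded ((hw ht).mul_right t) fun n ↦ ?_
    rw [← mul_sub, norm_mul, Real.norm_of_nonneg (Real.exp_pos _).le, Real.norm_eq_abs]
    gcongr
    exact (hE ht n).trans h1
  have hWt : W * t ≤ |y|⁻¹ + y ^ 2 := by
    have h5 : W ≤ |y|⁻¹ * c + y ^ 2 * t := by linarith [le_abs_self _ |>.trans hW2]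
    calc W * t ≤ (|y|⁻¹ * c + y ^ 2 * t) * t := by gcongr
      _ = |y|⁻¹ * √t + y ^ 2 * (t * t) := by rw [← hct]; ring
      _ ≤ |y|⁻¹ * 1 + y ^ 2 * (1 * 1) := by gcongr
      _ = _ := by ring
  have hWc : |W * c - |y|⁻¹ / t| ≤ y ^ 2 := by
    rw [hcc, show W * c - c * (|y|⁻¹ * c) = c * (W - |y|⁻¹ * c) by ring, abs_mul,
      abs_of_pos hcpos]
    calc c * |W - |y|⁻¹ * c| ≤ c * (y ^ 2 * t) := by gcongr
      _ = y ^ 2 * √t := by rw [← hct]; ring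
      _ ≤ y ^ 2 * 1 := by gcongr
      _ = y ^ 2 := mul_one _
  calc _ ≤ _ := abs_sub_le _ (W * c) _
    _ ≤ W * t + y ^ 2 := add_le_add hdiff hWc
    _ ≤ _ := by linarith

lemma exists_embedding_absNorm_eq (K : Type*) [Field K] [NumberField K]
    (hdeg : Module.finrank ℚ K = 2) (himag : ∀ v : InfinitePlace K, v.IsComplex) :
    ∃ σ : K →+* ℂ, ¬ ComplexEmbedding.IsReal σ ∧
      ∀ α : 𝓞 K, (Ideal.absNorm (Ideal.span {α}) : ℝ) = ‖σ α‖ ^ 2 := by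
  classical
  have : IsTotallyComplex K := ⟨himag⟩
  have hcard : Fintype.card (InfinitePlace K) = 1 := by
    have h1 := InfinitePlace.card_eq_nrRealPlaces_add_nrComplexPlaces K
    have h2 := IsTotallyComplex.finrank K
    have h3 := IsTotallyComplex.nrRealPlaces_eq_zero K
    omega
  obtain ⟨v, hv⟩ := Fintype.card_eq_one_iff.mp hcard
  refine ⟨v.embedding, InfinitePlace.isComplex_iff.mp (himag v), fun α ↦ ?_⟩
  have h := InfinitePlace.prod_eq_abs_norm (α : K)
  rw [Fintype.prod_eq_single v fun w hw ↦ (hw (hv w)).elim, IsTotallyComplex.mult_eq,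
    ← InfinitePlace.norm_embedding_eq] at h
  rw [h, Ideal.absNorm_span_singleton, ← Algebra.coe_norm_int, Nat.cast_natAbs]
  push_cast
  rfl

lemma exists_norm_form (K : Type*) [Field K] [NumberField K]
    (hdeg : Module.finrank ℚ K = 2) (himag : ∀ v : InfinitePlace K, v.IsComplex) :
    ∃ (e : 𝓞 K ≃ ℤ × ℤ) (A x y : ℝ), 0 < A ∧ y ≠ 0 ∧
      ∀ α : 𝓞 K, (Ideal.absNorm (Ideal.span {α}) : ℝ) =
        A * (((e α).2 + (e α).1 * x) ^ 2 + ((e α).1 * y) ^ 2) := by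
  obtain ⟨σ, hσ, hN⟩ := exists_embedding_absNorm_eq K hdeg himag
  have hcard : Fintype.card (Module.Free.ChooseBasisIndex ℤ (𝓞 K)) = 2 := by
    rw [← Module.finrank_eq_card_chooseBasisIndex, RingOfIntegers.rank, hdeg]
  let b := (RingOfIntegers.basis K).reindex (Fintype.equivFinOfCardEq hcard)
  have hb (α : 𝓞 K) : α = b.repr α 1 • b 1 + b.repr α 0 • b 0 := by
    conv_lhs => rw [← b.sum_repr α, Fin.sum_univ_two, add_comm]
  set τ : 𝓞 K →+* ℂ := σ.comp (algebraMap (𝓞 K) K) with hτ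
  have hτinj : Function.Injective τ := σ.injective.comp RingOfIntegers.coe_injective
  have hz1 : τ (b 1) ≠ 0 := (map_ne_zero_iff τ hτinj).mpr (b.ne_zero 1)
  set z := τ (b 0) / τ (b 1) with hz
  have hrep (α : 𝓞 K) : τ α = τ (b 1) * (b.repr α 1 + b.repr α 0 * z) := by
    conv_lhs => rw [hb α]
    simp only [map_add, zsmul_eq_mul, map_mul, map_intCast]
    rw [hz, mul_add]
    field_simp
  have hy : z.im ≠ 0 := by
    intro him
    apply hσ
    have hreal (α : 𝓞 K) : (starRingEnd ℂ) (τ α) = τ α := by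
      have h1 := hrep (α * b 1)
      rw [map_mul, mul_comm (τ α)] at h1
      rw [mul_left_cancel₀ hz1 h1]
      have hzc : (starRingEnd ℂ) z = z := conj_eq_iff_im.mpr him
      simp [hzc]
    rw [ComplexEmbedding.isReal_iff]
    ext k
    obtain ⟨p, q, hq, rfl⟩ := IsFractionRing.div_surjective (A := 𝓞 K) k
    have hp := hreal p
    have hq := hreal q
    simp only [hτ, RingHom.comp_apply] at hp hq
    simp only [ComplexEmbedding.conjugate_coe_eq, map_div₀, hp, hq]
  refine ⟨(b.equivFun.toEquiv).trans (finTwoArrowEquiv ℤ), ‖τ (b 1)‖ ^ 2, z.re, z.im, by positivity,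
    hy, fun α ↦ ?_⟩
  rw [hN, show σ α = τ α from rfl, hrep, norm_mul, mul_pow, Complex.sq_norm (_ + _),
    Complex.normSq_apply]
  simp
  ring_nf
  simp

open Topology in
/-- The theta series of the ideals of an imaginary quadratic field of class number one. -/
lemma ideal_theta (K : Type*) [Field K] [NumberField K]
    (hdeg : Module.finrank ℚ K = 2) (himag : ∀ v : InfinitePlace K, v.IsComplex)
    (hclass : NumberField.classNumber K = 1) {c : ℝ} (hc : 0 < c) :
    (∀ t : ℝ, 0 < t → Summable fun I : {I : Ideal (𝓞 K) // I ≠ ⊥} ↦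
      Real.exp (-(c * Ideal.absNorm I.1) * t)) ∧
    ∃ κ C : ℝ, ∀ᶠ t : ℝ in 𝓝[>] 0, |∑' I : {I : Ideal (𝓞 K) // I ≠ ⊥},
      Real.exp (-(c * Ideal.absNorm I.1) * t) - κ / t| ≤ C := by
  classical
  have hpir : IsPrincipalIdealRing (𝓞 K) := classNumber_eq_one_iff.mp hclass
  obtain ⟨e, A, x, y, hA, hy, hN⟩ := exists_norm_form K hdeg himag
  obtain ⟨hS, C, hC⟩ := theta_form x hy
  have hlam : 0 < c * A / Real.pi := by have := Real.pi_pos; positivity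
  set lam := c * A / Real.pi with hlamdef
  let f (t : ℝ) (α : 𝓞 K) : ℝ := Real.exp (-(c * Ideal.absNorm (Ideal.span {α})) * t)
  let g (t : ℝ) (p : ℤ × ℤ) : ℝ :=
    Real.exp (-Real.pi * ((p.2 + p.1 * x) ^ 2 + (p.1 * y) ^ 2) * t)
  have hfg (t : ℝ) : f t = g (lam * t) ∘ e := by
    ext α
    simp only [f, g, Function.comp_apply, hN, hlamdef]
    congr 1
    have := Real.pi_ne_zero
    field_simp
  have hfs {t : ℝ} (ht : 0 < t) : Summable (f t) := by
    rw [hfg]; exact (e.summable_iff).mpr (hS _ (mul_pos hlam ht))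
  choose gen hgen using fun I : {I : Ideal (𝓞 K) // I ≠ ⊥} ↦
    (IsPrincipalIdealRing.principal I.1).principal
  have hgen0 (I : {I : Ideal (𝓞 K) // I ≠ ⊥}) : gen I ≠ 0 := by
    intro h
    apply I.2
    rw [hgen I, h]; simp
  have hspan (I : {I : Ideal (𝓞 K) // I ≠ ⊥}) (u : (𝓞 K)ˣ) :
      Ideal.span {(u : 𝓞 K) * gen I} = I.1 := by
    rw [Ideal.span_singleton_mul_left_unit u.isUnit]; exact (hgen I).symm
  let Φ : {I : Ideal (𝓞 K) // I ≠ ⊥} × (𝓞 K)ˣ ≃ {α : 𝓞 K // α ≠ 0} := by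
    refine Equiv.ofBijective (fun q ↦ ⟨q.2 * gen q.1, mul_ne_zero q.2.ne_zero (hgen0 _)⟩) ⟨?_, ?_⟩
    · rintro ⟨I, u⟩ ⟨J, v⟩ h
      have h : (u : 𝓞 K) * gen I = v * gen J := congrArg Subtype.val h
      have hIJ : I = J := Subtype.ext (by rw [← hspan I u, h, hspan J v])
      subst hIJ
      exact Prod.ext rfl (Units.ext (mul_right_cancel₀ (hgen0 I) h))
    · rintro ⟨α, hα⟩
      let I : {I : Ideal (𝓞 K) // I ≠ ⊥} := ⟨Ideal.span {α}, by simpa using hα⟩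
      have h : Associated (gen I) α :=
        Ideal.span_singleton_eq_span_singleton.mp (hgen I).symm
      obtain ⟨u, hu⟩ := h
      exact ⟨(I, u), Subtype.ext ((mul_comm _ _).trans hu)⟩
  have hΦ (t : ℝ) (q : {I : Ideal (𝓞 K) // I ≠ ⊥} × (𝓞 K)ˣ) :
      f t (Φ q).1 = Real.exp (-(c * Ideal.absNorm q.1.1) * t) := by
    simp only [f]
    rw [show ((Φ q).1 : 𝓞 K) = q.2 * gen q.1 from rfl, hspan]
  have hprod {t : ℝ} (ht : 0 < t) : Summable fun q : {I : Ideal (𝓞 K) // I ≠ ⊥} × (𝓞 K)ˣ ↦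
      Real.exp (-(c * Ideal.absNorm q.1.1) * t) := by
    have h1 : Summable fun α : {α : 𝓞 K // α ≠ 0} ↦ f t α := (hfs ht).subtype _
    have := Φ.summable_iff.mpr h1
    exact this.congr fun q ↦ hΦ t q
  have hfin : Finite (𝓞 K)ˣ := by
    by_contra hinf
    rw [not_finite_iff_infinite] at hinf
    have h1 : Summable fun _ : (𝓞 K)ˣ ↦
        Real.exp (-(c * Ideal.absNorm (⊤ : Ideal (𝓞 K))) * 1) :=
      (hprod one_pos).prod_factor ⟨⊤, top_ne_bot⟩
    rw [summable_const_iff] at h1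
    exact (Real.exp_pos _).ne' h1
  have hFs {t : ℝ} (ht : 0 < t) : Summable fun I : {I : Ideal (𝓞 K) // I ≠ ⊥} ↦
      Real.exp (-(c * Ideal.absNorm I.1) * t) :=
    (hprod ht).comp_injective (i := fun I ↦ (I, 1)) fun _ _ h ↦ (Prod.ext_iff.mp h).1
  refine ⟨fun t ht ↦ hFs ht, ?_⟩
  have hw : 0 < (Nat.card (𝓞 K)ˣ : ℝ) := by exact_mod_cast Nat.card_pos
  set w : ℝ := (Nat.card (𝓞 K)ˣ : ℝ) with hwdef
  have htot {t : ℝ} (ht : 0 < t) : ∑' p, g (lam * t) p =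
      1 + w * ∑' I : {I : Ideal (𝓞 K) // I ≠ ⊥}, Real.exp (-(c * Ideal.absNorm I.1) * t) := by
    have h1 : ∑' p, g (lam * t) p = ∑' α, f t α := by
      rw [hfg]; exact (e.tsum_eq _).symm
    have h2 := (hfs ht).tsum_subtype_add_tsum_subtype_compl {α | α ≠ 0}
    have h3 : ∑' α : ↑({α : 𝓞 K | α ≠ 0}ᶜ), f t α = 1 := by
      have : ({α : 𝓞 K | α ≠ 0}ᶜ) = {0} := by ext; simp
      rw [this, tsum_singleton]
      simp [f]
    have h4 : ∑' α : {α : 𝓞 K | α ≠ 0}, f t α =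
        w * ∑' I : {I : Ideal (𝓞 K) // I ≠ ⊥}, Real.exp (-(c * Ideal.absNorm I.1) * t) := by
      have h5 : ∑' q, f t (Φ q) = ∑' α : {α : 𝓞 K // α ≠ 0}, f t α :=
        Φ.tsum_eq fun α : {α : 𝓞 K // α ≠ 0} ↦ f t α
      rw [show (∑' α : {α : 𝓞 K | α ≠ 0}, f t α) = ∑' α : {α : 𝓞 K // α ≠ 0}, f t α from rfl,
        ← h5]
      simp_rw [hΦ]
      rw [(hprod ht).tsum_prod]
      simp_rw [tsum_const, nsmul_eq_mul]
      rw [tsum_mul_left]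
    rw [h1, ← h2, h3, h4, add_comm]
  refine ⟨|y|⁻¹ / lam / w, (C + 1) / w, ?_⟩
  have hlim : Tendsto (fun t : ℝ ↦ lam * t) (𝓝[>] 0) (𝓝[>] 0) := by
    refine tendsto_nhdsWithin_iff.mpr ⟨?_, ?_⟩
    · exact ((continuous_const_mul lam).tendsto' 0 0 (mul_zero _)).mono_left nhdsWithin_le_nhds
    · filter_upwards [self_mem_nhdsWithin] with t ht
      exact mul_pos hlam ht
  filter_upwards [hlim.eventually hC, self_mem_nhdsWithin] with t h1 (ht : 0 < t)
  have h2 := htot ht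
  simp only [g] at h2
  rw [h2] at h1
  set F := ∑' I : {I : Ideal (𝓞 K) // I ≠ ⊥}, Real.exp (-(c * Ideal.absNorm I.1) * t)
  have h3 : F - |y|⁻¹ / lam / w / t = (w * F - |y|⁻¹ / (lam * t)) / w := by
    field_simp
  rw [h3, abs_div, abs_of_pos hw]
  gcongr
  have h4 := abs_sub_abs_le_abs_sub (w * F - |y|⁻¹ / (lam * t)) (-1)
  rw [abs_neg, abs_one] at h4
  have h5 : w * F - |y|⁻¹ / (lam * t) - -1 = 1 + w * F - |y|⁻¹ / (lam * t) := by ring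
  rw [h5] at h4
  linarith

open Topology MeasureTheory Set in
/-- Continuation to `0 < re s`, with bounds on vertical strips, of a Dirichlet series whose theta
series is `κ / t + O(1)` at `0`. -/
lemma exists_mellin_continuation {ι : Type*} {n : ι → ℕ} (hn : ∀ i, 1 ≤ n i) {c : ℝ} (hc : 0 < c)
    (hexp : ∀ t : ℝ, 0 < t → Summable fun i ↦ Real.exp (-(c * n i) * t)) {κ C : ℝ}
    (hC : ∀ᶠ t : ℝ in 𝓝[>] 0, |∑' i, Real.exp (-(c * n i) * t) - κ / t| ≤ C)
    (hsum : ∀ σ : ℝ, 1 < σ → Summable fun i ↦ (n i : ℝ) ^ (-σ)) :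
    ∃ h : ℂ → ℂ, (∀ s : ℂ, 0 < s.re → DifferentiableAt ℂ h s) ∧
      (∃ M : ℝ, ∀ s : ℂ, 1 / 4 ≤ s.re → s.re ≤ 3 → ‖h s‖ ≤ M) ∧
      ∀ s : ℂ, 1 < s.re →
        Gamma s * ∑' i, (((c * n i : ℝ) : ℂ) ^ s)⁻¹ = h s + κ / (s - 1) := by
  have : Countable ι := by
    have h1 := (hexp 1 one_pos).countable_support
    rwa [Function.support_eq_univ fun i ↦ (Real.exp_pos _).ne', countable_univ_iff] at h1
  have hp (i : ι) : 0 < c * n i := mul_pos hc (by exact_mod_cast hn i)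
  set F : ℝ → ℝ := fun t ↦ ∑' i, Real.exp (-(c * n i) * t) with hF
  have hFanti : AntitoneOn F (Ioi 0) := fun t ht u hu htu ↦
    (hexp u hu).tsum_le_tsum (fun i ↦ Real.exp_le_exp.mpr (by
      have := mul_le_mul_of_nonneg_left htu (hp i).le
      linarith)) (hexp t ht)
  have hF0 (t : ℝ) : 0 ≤ F t := tsum_nonneg fun i ↦ (Real.exp_pos _).le
  have hFdecay (t : ℝ) (ht : 1 < t) : F t ≤ F 1 * Real.exp c * Real.exp (-c * t) := by
    rw [mul_assoc, ← Real.exp_add, mul_comm]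
    simp only [hF]
    rw [← tsum_mul_left]
    refine (hexp t (by linarith)).tsum_le_tsum (fun i ↦ ?_) ((hexp 1 one_pos).mul_left _)
    rw [← Real.exp_add, Real.exp_le_exp]
    have h1 : (1 : ℝ) ≤ n i := by exact_mod_cast hn i
    nlinarith [mul_nonneg (mul_nonneg hc.le (sub_nonneg.mpr h1)) (sub_nonneg.mpr ht.le)]
  set J : ℝ → ℂ := fun t ↦ (κ : ℂ) • indicator (Ioc 0 1) (fun t : ℝ ↦ (t : ℂ) ^ (-1 : ℂ)) t with hJ
  set g : ℝ → ℂ := fun t ↦ (F t : ℂ) - J t with hg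
  have hJ1 (t : ℝ) (h0 : 0 < t) (h1 : t ≤ 1) : J t = (κ / t : ℝ) := by
    simp only [hJ]
    rw [indicator_of_mem (show t ∈ Ioc (0 : ℝ) 1 from ⟨h0, h1⟩), cpow_neg_one, smul_eq_mul]
    push_cast; ring
  have hJ2 (t : ℝ) (h1 : 1 < t) : J t = 0 := by
    simp only [hJ]
    rw [indicator_of_notMem (fun h ↦ h1.not_ge h.2), smul_zero]
  have hgloc : LocallyIntegrableOn g (Ioi 0) := by
    rw [locallyIntegrableOn_iff isOpen_Ioi.isLocallyClosed]
    intro k hk hkc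
    refine Integrable.sub ?_ ?_
    · exact ((hFanti.mono hk).integrableOn_isCompact hkc).ofReal
    · refine Integrable.smul (κ : ℂ) ?_
      refine IntegrableOn.indicator ?_ measurableSet_Ioc
      refine ContinuousOn.integrableOn_compact hkc fun t ht ↦ ContinuousAt.continuousWithinAt ?_
      exact continuousAt_ofReal_cpow_const _ _ (Or.inr (hk ht).ne')
  have hgtop : g =O[atTop] fun t ↦ Real.exp (-c * t) := by
    refine Asymptotics.IsBigO.of_bound (F 1 * Real.exp c) ?_
    filter_upwards [eventually_gt_atTop 1] with t ht
    simp only [hg]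
    rw [hJ2 t ht, sub_zero, norm_real, Real.norm_of_nonneg (hF0 t),
      Real.norm_of_nonneg (Real.exp_pos _).le]
    exact hFdecay t ht
  have hgbot : g =O[𝓝[>] 0] fun t : ℝ ↦ t ^ (-(0 : ℝ)) := by
    refine Asymptotics.IsBigO.of_bound C ?_
    filter_upwards [hC, Ioc_mem_nhdsGT one_pos] with t ht h1
    simp only [hg]
    rw [hJ1 t h1.1 h1.2, ← ofReal_sub, norm_real]
    rw [neg_zero, Real.rpow_zero, norm_one, mul_one, Real.norm_eq_abs]
    exact ht
  have hconv (s : ℂ) (hs : 0 < s.re) : MellinConvergent g s :=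
    mellinConvergent_of_isBigO_rpow_exp hc hgloc hgtop hgbot hs
  refine ⟨mellin g, fun s hs ↦ mellin_differentiableAt_of_isBigO_rpow_exp hc hgloc hgtop hgbot hs,
    ?_, fun s hs ↦ ?_⟩
  · have hgInt (σ : ℝ) (hσ : 0 < σ) : IntegrableOn (fun t : ℝ ↦ t ^ (σ - 1) * ‖g t‖) (Ioi 0) :=
      mellin_convergent_of_isBigO_scalar hgloc.norm
        (hgtop.norm_left.trans (isLittleO_exp_neg_mul_rpow_atTop hc _).isBigO) (lt_add_one _)
        hgbot.norm_left hσ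
    refine ⟨∫ t in Ioi 0, (t ^ ((1 / 4 : ℝ) - 1) * ‖g t‖ + t ^ ((3 : ℝ) - 1) * ‖g t‖),
      fun s h1 h2 ↦ ?_⟩
    refine norm_integral_le_of_norm_le ((hgInt _ (by norm_num)).add (hgInt _ (by norm_num))) ?_
    filter_upwards [ae_restrict_mem measurableSet_Ioi] with t (ht : 0 < t)
    rw [norm_smul, norm_cpow_eq_rpow_re_of_pos ht, sub_re, one_re, ← add_mul]
    gcongr
    rcases le_total t 1 with h | h
    · exact (Real.rpow_le_rpow_of_exponent_ge ht h (by linarith)).trans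
        (le_add_of_nonneg_right (Real.rpow_nonneg ht.le _))
    · exact (Real.rpow_le_rpow_of_exponent_le h (by linarith)).trans
        (le_add_of_nonneg_left (Real.rpow_nonneg ht.le _))
  · have hs0 : 0 < s.re := by linarith
    have h1 : HasSum (fun i ↦ Gamma s * (1 : ℂ) / ((c * n i : ℝ) : ℂ) ^ s)
        (mellin (fun t ↦ (F t : ℂ)) s) := by
      refine hasSum_mellin (fun i ↦ Or.inr (hp i)) hs0 (fun t ht ↦ ?_) ?_
      · simpa only [one_mul] using Complex.hasSum_ofReal.mpr (hexp t ht).hasSum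
      · refine ((hsum s.re hs).mul_left (c ^ (-s.re))).congr fun i ↦ ?_
        rw [norm_one, Real.mul_rpow hc.le (Nat.cast_nonneg _), one_div, mul_inv,
          Real.rpow_neg hc.le, Real.rpow_neg (Nat.cast_nonneg _)]
    have h2 := (hasMellin_cpow_Ioc (-1) (s := s) (by simpa using hs))
    have h3 := hasMellin_const_smul h2.1 (κ : ℂ)
    have h4 := (hasMellin_add (hconv s hs0) h3.1).2
    have h5 : (fun t ↦ g t + (κ : ℂ) • indicator (Ioc 0 1) (fun t : ℝ ↦ (t : ℂ) ^ (-1 : ℂ)) t) =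
        fun t ↦ (F t : ℂ) := by
      ext t; simp only [hg, hJ]; ring
    rw [h5, h3.2, h2.2] at h4
    rw [← tsum_mul_left]
    have h6 := h1.tsum_eq
    simp only [mul_one, div_eq_mul_inv] at h6
    rw [h6, h4, smul_eq_mul]
    ring

lemma one_le_absNorm {K : Type*} [Field K] [NumberField K] (I : {I : Ideal (𝓞 K) // I ≠ ⊥}) :
    1 ≤ Ideal.absNorm I.1 :=
  Nat.one_le_iff_ne_zero.mpr fun h ↦ I.2 (Ideal.absNorm_eq_zero_iff.mp h)

lemma norm_absNorm_cpow {K : Type*} [Field K] [NumberField K] (I : {I : Ideal (𝓞 K) // I ≠ ⊥})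
    (s : ℂ) : ‖(Ideal.absNorm I.1 : ℂ) ^ (-s)‖ = (Ideal.absNorm I.1 : ℝ) ^ (-s.re) := by
  rw [norm_natCast_cpow_of_pos (one_le_absNorm I), neg_re]

open Topology in
/-- The Dedekind zeta series converges for `1 < σ`: otherwise its (junk) sum vanishes to the right
of `1`, contradicting the pole. -/
lemma IsCompletedDedekindZeta.summable {K : Type*} [Field K] [NumberField K] {ΛK : ℂ → ℂ}
    (hΛ : IsCompletedDedekindZeta K ΛK) {σ : ℝ} (hσ : 1 < σ) :
    Summable fun I : {I : Ideal (𝓞 K) // I ≠ ⊥} ↦ (Ideal.absNorm I.1 : ℝ) ^ (-σ) := by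
  by_contra hns
  obtain ⟨r, hr, hlim⟩ := hΛ.simple_pole_at_one
  have h1 : Tendsto (fun x : ℝ ↦ (x : ℂ)) (𝓝[>] 1) (𝓝[≠] 1) := by
    refine tendsto_nhdsWithin_iff.mpr ⟨?_, ?_⟩
    · exact (continuous_ofReal.tendsto' 1 1 ofReal_one).mono_left nhdsWithin_le_nhds
    · filter_upwards [self_mem_nhdsWithin] with x (hx : 1 < x)
      simpa using hx.ne'
  refine hr (tendsto_nhds_unique (hlim.comp h1) (tendsto_const_nhds.congr' ?_))
  filter_upwards [Ioc_mem_nhdsGT hσ] with x hx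
  have h0 : dedekindZetaSum K x = 0 := by
    refine tsum_eq_zero_of_not_summable fun h ↦ hns ?_
    refine Summable.of_nonneg_of_le (fun I ↦ by positivity) (fun I ↦ ?_) h.norm
    rw [norm_absNorm_cpow, ofReal_re]
    exact Real.rpow_le_rpow_of_exponent_le (by exact_mod_cast one_le_absNorm I) (by linarith [hx.2])
  simp [hΛ.eq_on_gt_one x (by simpa using hx.1), h0]

lemma sqrt_discr_div_pos (K : Type*) [Field K] [NumberField K] :
    0 < Real.sqrt |(NumberField.discr K : ℝ)| / (2 * Real.pi) := by
  have := NumberField.discr_ne_zero K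
  positivity

section Xi

variable {K : Type*} [Field K] [NumberField K] {ΛK : ℂ → ℂ} {ξK : ℂ → ℂ}

lemma eq_of_eqOn_one_lt_re {f g : ℂ → ℂ} {x : ℝ} (hx : x ≤ 1)
    (hf : ∀ s : ℂ, x < s.re → DifferentiableAt ℂ f s)
    (hg : ∀ s : ℂ, x < s.re → DifferentiableAt ℂ g s) (hfg : ∀ s : ℂ, 1 < s.re → f s = g s)
    {s : ℂ} (hs : x < s.re) : f s = g s := by
  have ho : IsOpen {s : ℂ | x < s.re} := isOpen_lt continuous_const continuous_re
  refine AnalyticOnNhd.eqOn_of_preconnected_of_eventuallyEq (U := {s : ℂ | x < s.re}) (z₀ := 2)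
    (DifferentiableOn.analyticOnNhd (fun s hs ↦ (hf s hs).differentiableWithinAt) ho)
    (DifferentiableOn.analyticOnNhd (fun s hs ↦ (hg s hs).differentiableWithinAt) ho)
    (convex_halfSpace_re_gt x).isPreconnected ?_ ?_ hs
  · simp only [Set.mem_ofPred_eq, re_ofNat]; linarith
  · filter_upwards [(isOpen_lt continuous_const continuous_re).mem_nhds
      (show (1 : ℝ) < (2 : ℂ).re by norm_num)] with s hs using hfg s hs

lemma xi_one_sub (hΛ : IsCompletedDedekindZeta K ΛK) (hξdiff : Differentiable ℂ ξK)
    (hξeq : ∀ s : ℂ, s ≠ 0 → s ≠ 1 → ξK s = s * (s - 1) * ΛK s) (s : ℂ) : ξK (1 - s) = ξK s := by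
  refine congrFun (Continuous.ext_on (f := fun s ↦ ξK (1 - s)) (g := ξK) (s := {(0 : ℂ), 1}ᶜ)
    ((Set.toFinite _).countable.dense_compl ℂ)
    (hξdiff.continuous.comp (continuous_const.sub continuous_id)) hξdiff.continuous ?_) s
  intro s hs
  simp only [Set.mem_compl_iff, Set.mem_insert_iff, Set.mem_singleton_iff, not_or] at hs
  beta_reduce
  rw [hξeq s hs.1 hs.2, hξeq (1 - s) (sub_ne_zero.mpr (Ne.symm hs.2))
    (fun h ↦ hs.1 (by linear_combination -h)), ← hΛ.functional_equation]
  ring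

open ComplexConjugate

lemma dedekindZetaSum_conj (s : ℂ) :
    dedekindZetaSum K (conj s) = conj (dedekindZetaSum K s) := by
  rw [dedekindZetaSum, dedekindZetaSum, conj_tsum]
  refine tsum_congr fun I ↦ ?_
  rw [← map_neg, cpow_conj _ _ (by rw [natCast_arg]; exact Real.pi_pos.ne), conj_natCast]

lemma xi_conj (hΛ : IsCompletedDedekindZeta K ΛK) (hξdiff : Differentiable ℂ ξK)
    (hξeq : ∀ s : ℂ, s ≠ 0 → s ≠ 1 → ξK s = s * (s - 1) * ΛK s) (s : ℂ) :
    ξK (conj s) = conj (ξK s) := by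
  have key : ∀ s, conj (ξK (conj s)) = ξK s := by
    intro s
    refine eq_of_eqOn_one_lt_re (x := min (s.re - 1) 1) (min_le_right _ _)
      (f := fun s ↦ conj (ξK (conj s))) (fun s _ ↦ ?_) (fun s _ ↦ hξdiff s) (fun s hs ↦ ?_) ?_
    · have := (hξdiff (conj s)).conj_conj
      rwa [conj_conj] at this
    · have h0 : s ≠ 0 := by rintro rfl; simp at hs; linarith
      have h1 : s ≠ 1 := by rintro rfl; simp at hs
      have hq := (sqrt_discr_div_pos K).le
      rw [hξeq _ h0 h1, hξeq _ ((map_ne_zero _).mpr h0)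
          (fun h ↦ h1 (by simpa using congrArg conj h)), hΛ.eq_on_gt_one s hs,
        hΛ.eq_on_gt_one (conj s) (by simpa using hs), dedekindZetaSum_conj, Gamma_conj]
      simp only [map_mul, conj_conj, map_sub, map_one]
      rw [cpow_conj _ _ (by rw [arg_ofReal_of_nonneg hq]; exact Real.pi_pos.ne), conj_ofReal,
        conj_conj]
    · exact (min_le_left _ _).trans_lt (by linarith)
  rw [← key s, conj_conj]

/-- Polynomial growth of `ξ_K` on a vertical strip. -/
lemma exists_norm_xi_le (hdeg : Module.finrank ℚ K = 2) (himag : ∀ v : InfinitePlace K, v.IsComplex)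
    (hclass : NumberField.classNumber K = 1) (hΛ : IsCompletedDedekindZeta K ΛK)
    (hξdiff : Differentiable ℂ ξK)
    (hξeq : ∀ s : ℂ, s ≠ 0 → s ≠ 1 → ξK s = s * (s - 1) * ΛK s) :
    ∃ M : ℝ, ∀ s : ℂ, -2 ≤ s.re → s.re ≤ 3 → ‖ξK s‖ ≤ M * (1 + ‖s‖) ^ 2 := by
  set q : ℝ := Real.sqrt |(NumberField.discr K : ℝ)| / (2 * Real.pi) with hq
  have hq0 : 0 < q := sqrt_discr_div_pos K
  have hc : 0 < q⁻¹ := inv_pos.mpr hq0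
  obtain ⟨hexp, κ, C, hC⟩ := ideal_theta K hdeg himag hclass hc
  obtain ⟨h, hd, ⟨M, hM⟩, heq⟩ := exists_mellin_continuation one_le_absNorm hc hexp hC
    (fun σ hσ ↦ hΛ.summable hσ)
  have hξ {s : ℂ} (hs : 0 < s.re) : ξK s = s * ((s - 1) * h s + κ) := by
    refine eq_of_eqOn_one_lt_re zero_le_one (fun s _ ↦ hξdiff s)
      (g := fun s ↦ s * ((s - 1) * h s + κ)) (fun s hs ↦ ?_) (fun s hs ↦ ?_) hs
    · have := hd s hs; fun_prop
    · have h0 : s ≠ 0 := by rintro rfl; simp at hs; linarith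
      have h1 : s ≠ 1 := by rintro rfl; simp at hs
      have h1' := sub_ne_zero.mpr h1
      have h2 : ΛK s = h s + κ / (s - 1) := by
        rw [← heq s hs, hΛ.eq_on_gt_one s hs, ← hq, dedekindZetaSum, mul_comm (_ ^ _), mul_assoc,
          ← tsum_mul_left]
        congr 1
        refine tsum_congr fun I ↦ ?_
        rw [ofReal_mul, mul_cpow_ofReal_nonneg hc.le (Nat.cast_nonneg _), mul_inv, ofReal_inv,
          inv_cpow _ _ (by rw [arg_ofReal_of_nonneg hq0.le]; exact Real.pi_pos.ne), inv_inv,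
          cpow_neg, ofReal_natCast]
      rw [hξeq s h0 h1, h2]
      field_simp
  have hM0 : 0 ≤ M := (norm_nonneg _).trans (hM 1 (by norm_num) (by norm_num))
  have hb {s : ℂ} (h1 : 1 / 4 ≤ s.re) (h2 : s.re ≤ 3) : ‖ξK s‖ ≤ (M + |κ|) * (1 + ‖s‖) ^ 2 := by
    rw [hξ (by linarith), norm_mul]
    have h3 : ‖s - 1‖ ≤ 1 + ‖s‖ := by
      rw [add_comm]; simpa using norm_sub_le s 1
    have h4 : ‖(s - 1) * h s + κ‖ ≤ (1 + ‖s‖) * M + |κ| := by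
      refine (norm_add_le _ _).trans ?_
      rw [norm_mul, norm_real, Real.norm_eq_abs]
      gcongr
      exact hM s h1 h2
    refine (mul_le_mul_of_nonneg_left h4 (norm_nonneg _)).trans ?_
    have := norm_nonneg s
    nlinarith [mul_nonneg (norm_nonneg s) hM0, mul_nonneg (norm_nonneg s) (abs_nonneg κ),
      mul_nonneg (sq_nonneg ‖s‖) (abs_nonneg κ), abs_nonneg κ]
  refine ⟨4 * (M + |κ|), fun s h1 h2 ↦ ?_⟩
  have h5 : (1 + ‖s‖) ^ 2 ≤ 4 * (1 + ‖s‖) ^ 2 := by nlinarith [sq_nonneg (1 + ‖s‖)]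
  have h6 : 0 ≤ M + |κ| := by positivity
  rw [mul_assoc]
  rcases le_total (1 / 4) s.re with h | h
  · exact (hb h h2).trans (by rw [mul_left_comm]; exact mul_le_mul_of_nonneg_left h5 h6)
  · rw [← xi_one_sub hΛ hξdiff hξeq]
    refine (hb (s := 1 - s) (by simp; linarith) (by simp; linarith)).trans ?_
    rw [mul_left_comm]
    refine mul_le_mul_of_nonneg_left ?_ h6
    have h3 : ‖1 - s‖ ≤ 1 + ‖s‖ := by simpa using norm_sub_le 1 s
    have := norm_nonneg s
    nlinarith [norm_nonneg (1 - s)]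

end Xi

section Euler

variable {α : Type*} [CommMonoidWithZero α] [IsCancelMulZero α] [Subsingleton αˣ]

/-- Removing finitely many Euler factors from a completely multiplicative series. -/
lemma tsum_indicator_not_dvd {𝕜 : Type*} [NormedField 𝕜] [CompleteSpace 𝕜] (f : α →*₀ 𝕜)
    (hf : Summable fun x ↦ ‖f x‖) (T : Finset α) (hT : ∀ p ∈ T, Prime p) :
    ∑' x, Set.indicator {x | ∀ p ∈ T, ¬ p ∣ x} f x = (∏ p ∈ T, (1 - f p)) * ∑' x, f x := by
  classical
  induction T using Finset.induction_on with
  | empty => simp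
  | insert p T hpT ih =>
    have hp : Prime p := hT p (Finset.mem_insert_self p T)
    specialize ih fun q hq ↦ hT q (Finset.mem_insert_of_mem hq)
    rw [Finset.prod_insert hpT, mul_assoc, ← ih]
    set A : Set α := {x | ∀ q ∈ T, ¬ q ∣ x} with hA
    have hmul : (f p * ∑' x, A.indicator f x) = ∑' x, (A ∩ {x | p ∣ x}).indicator f x := by
      rw [← tsum_mul_left, ← (mul_right_injective₀ hp.ne_zero).tsum_eq
        (f := (A ∩ {x | p ∣ x}).indicator f)]
      · refine tsum_congr fun x ↦ ?_
        have : p * x ∈ A ∩ {x | p ∣ x} ↔ x ∈ A := by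
          simp only [hA, Set.mem_inter_iff, Set.mem_ofPred_eq, dvd_mul_right, and_true]
          refine forall₂_congr fun q hq ↦ not_congr ⟨fun h ↦ ?_, fun h ↦ h.mul_left p⟩
          refine ((hT q (Finset.mem_insert_of_mem hq)).dvd_or_dvd h).resolve_left fun h' ↦ hpT ?_
          rwa [← associated_iff_eq.mp
            (((hT q (Finset.mem_insert_of_mem hq)).dvd_prime_iff_associated hp).mp h')]
        by_cases hx : x ∈ A
        · rw [Set.indicator_of_mem hx, Set.indicator_of_mem (this.mpr hx), map_mul]
        · rw [Set.indicator_of_notMem hx, Set.indicator_of_notMem (mt this.mp hx), mul_zero]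
      · intro x hx
        obtain ⟨y, rfl⟩ := (Set.mem_of_indicator_ne_zero hx).2
        exact ⟨y, rfl⟩
    rw [sub_mul, one_mul, hmul, ← (hf.of_norm.indicator _).tsum_sub (hf.of_norm.indicator _)]
    refine tsum_congr fun x ↦ ?_
    by_cases hx : x ∈ A <;> by_cases hpx : p ∣ x <;>
      simp_all [Set.indicator]

/-- A completely multiplicative series is bounded below by the inverse of the sum of the
absolute values of its terms. -/
lemma one_le_norm_tsum_mul_tsum_norm {α : Type*} [CommMonoidWithZero α] [Subsingleton αˣ]
    [UniqueFactorizationMonoid α] (f : α →*₀ ℂ)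
    (hf : Summable fun x ↦ ‖f x‖) : 1 ≤ ‖∑' x, f x‖ * ∑' x, ‖f x‖ := by
  classical
  set Z := ∑' x, ‖f x‖
  have hlt {p : α} (hp : Prime p) : ‖f p‖ < 1 := by
    by_contra! h
    have h1 : Summable fun k : ℕ ↦ ‖f (p ^ k)‖ :=
      hf.comp_injective (pow_injective_of_not_isUnit hp.not_isUnit hp.ne_zero)
    have h2 := h1.tendsto_atTop_zero
    refine absurd (ge_of_tendsto' h2 (b := 1) fun k ↦ ?_) (by norm_num)
    rw [map_pow, norm_pow]
    exact one_le_pow₀ h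
  have hprod (T : Finset α) (hT : ∀ p ∈ T, Prime p) : ∏ p ∈ T, (1 + ‖f p‖) ≤ Z := by
    have h1 := tsum_indicator_not_dvd ((normHom : ℂ →*₀ ℝ).comp f) (by simpa using hf) T hT
    have h2 : 1 ≤ ∑' x, Set.indicator {x | ∀ p ∈ T, ¬ p ∣ x} ((normHom : ℂ →*₀ ℝ).comp f) x := by
      have hs : Summable ((normHom : ℂ →*₀ ℝ).comp f) := hf
      have := (hs.indicator {x | ∀ p ∈ T, ¬ p ∣ x}).le_tsum 1 fun x _ ↦
        Set.indicator_nonneg (fun x _ ↦ norm_nonneg (f x)) x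
      rwa [Set.indicator_of_mem (show (1 : α) ∈ {x | ∀ p ∈ T, ¬ p ∣ x} from
        fun p hp h ↦ (hT p hp).not_isUnit (isUnit_of_dvd_one h)),
        map_one] at this
    rw [h1] at h2
    calc ∏ p ∈ T, (1 + ‖f p‖)
        ≤ (∏ p ∈ T, (1 + ‖f p‖)) * ((∏ p ∈ T, (1 - ‖f p‖)) * Z) :=
          le_mul_of_one_le_right (Finset.prod_nonneg fun p _ ↦ by positivity) h2
      _ = (∏ p ∈ T, (1 - ‖f p‖ ^ 2)) * Z := by
          rw [← mul_assoc, ← Finset.prod_mul_distrib]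
          congr 1
          exact Finset.prod_congr rfl fun p _ ↦ by ring
      _ ≤ 1 * Z := by
          refine mul_le_mul_of_nonneg_right (Finset.prod_le_one (fun p hp ↦ ?_) fun p hp ↦ ?_)
            (tsum_nonneg fun _ ↦ norm_nonneg _)
          · have := hlt (hT p hp)
            nlinarith [norm_nonneg (f p)]
          · nlinarith [norm_nonneg (f p)]
      _ = Z := one_mul Z
  refine le_of_forall_sub_le fun ε hε ↦ ?_
  obtain ⟨S, hS⟩ := ((tendsto_tsum_compl_atTop_zero fun x ↦ ‖f x‖).eventually
    (gt_mem_nhds hε)).exists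
  have hex (x : α) : ∃ p, x ≠ 0 → x ≠ 1 → Prime p ∧ p ∣ x := by
    by_cases h : x = 0 ∨ x = 1
    · exact ⟨x, by tauto⟩
    · push Not at h
      obtain ⟨p, hp, hpx⟩ := WfDvdMonoid.exists_irreducible_factor (mt isUnit_iff_eq_one.mp h.2) h.1
      exact ⟨p, fun _ _ ↦ ⟨hp.prime, hpx⟩⟩
  choose P hP using hex
  set T := (S.filter fun x ↦ x ≠ 0 ∧ x ≠ 1).image P with hTdef
  have hT : ∀ p ∈ T, Prime p := by
    intro p hp
    obtain ⟨x, hx, rfl⟩ := Finset.mem_image.mp hp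
    obtain ⟨-, h0, h1⟩ := Finset.mem_filter.mp hx
    exact (hP x h0 h1).1
  set A : Set α := {x | ∀ p ∈ T, ¬ p ∣ x} with hA
  have h1A : (1 : α) ∈ A := fun p hp h ↦ (hT p hp).not_isUnit (isUnit_of_dvd_one h)
  have hA1 : ‖∑' x, A.indicator f x - 1‖ ≤ ε := by
    have h1 : ∑' x, A.indicator f x - 1 = ∑' x, (A.indicator f x - if x = 1 then 1 else 0) := by
      rw [(hf.of_norm.indicator A).tsum_sub (summable_of_hasFiniteSupport
        ((Set.finite_singleton (1 : α)).subset fun x hx ↦ by simpa using hx)), tsum_ite_eq]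
    rw [h1]
    refine (tsum_of_norm_bounded (g := fun x ↦ {x | x ∉ S}.indicator (fun x ↦ ‖f x‖) x)
      (hf.indicator _).hasSum fun x ↦ ?_).trans ?_
    · by_cases hx1 : x = 1
      · subst hx1
        rw [Set.indicator_of_mem h1A, map_one, if_pos rfl, sub_self, norm_zero]
        exact Set.indicator_nonneg (fun _ _ ↦ norm_nonneg _) _
      rw [if_neg hx1, sub_zero, norm_indicator_eq_indicator_norm]
      by_cases hx0 : x = 0
      · simp [hx0, Set.indicator]
      by_cases hxS : x ∈ S
      · rw [Set.indicator_of_notMem (s := A), Set.indicator_of_notMem (not_not.mpr hxS)]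
        exact fun hxA ↦ hxA (P x) (Finset.mem_image_of_mem P
          (Finset.mem_filter.mpr ⟨hxS, hx0, hx1⟩)) (hP x hx0 hx1).2
      · rw [Set.indicator_of_mem (s := {x | x ∉ S}) hxS]
        exact Set.indicator_le_self' (fun _ _ ↦ norm_nonneg _) x
    · rw [← tsum_subtype]
      exact hS.le
  rw [tsum_indicator_not_dvd f hf T hT] at hA1
  have h2 : 1 - ε ≤ ‖(∏ p ∈ T, (1 - f p)) * ∑' x, f x‖ := by
    have := norm_sub_norm_le (1 : ℂ) ((∏ p ∈ T, (1 - f p)) * ∑' x, f x)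
    rw [norm_one, norm_sub_rev] at this
    linarith
  refine h2.trans ?_
  rw [norm_mul, mul_comm, norm_prod]
  refine mul_le_mul_of_nonneg_left ((Finset.prod_le_prod (fun _ _ ↦ norm_nonneg _)
    fun p _ ↦ ?_).trans (hprod T hT)) (norm_nonneg _)
  simpa using norm_sub_le 1 (f p)

end Euler

/-- The Dedekind zeta function at a real point. -/
noncomputable def realZetaSum (K : Type*) [Field K] [NumberField K] (σ : ℝ) : ℝ :=
  ∑' I : {I : Ideal (𝓞 K) // I ≠ ⊥}, (Ideal.absNorm I.1 : ℝ) ^ (-σ)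

section Zeta

variable {K : Type*} [Field K] [NumberField K] {ΛK : ℂ → ℂ}

lemma dedekindZetaSum_ofReal (σ : ℝ) : dedekindZetaSum K σ = realZetaSum K σ := by
  rw [dedekindZetaSum, realZetaSum, ofReal_tsum]
  refine tsum_congr fun I ↦ ?_
  rw [ofReal_cpow (Nat.cast_nonneg _), ofReal_natCast, ofReal_neg]

lemma norm_dedekindZetaSum_le (hΛ : IsCompletedDedekindZeta K ΛK) {s : ℂ} (hs : 1 < s.re) :
    ‖dedekindZetaSum K s‖ ≤ realZetaSum K s.re :=
  tsum_of_norm_bounded (hΛ.summable hs).hasSum fun I ↦ (norm_absNorm_cpow I s).le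

lemma realZetaSum_anti (hΛ : IsCompletedDedekindZeta K ΛK) {σ τ : ℝ} (hσ : 1 < σ) (h : σ ≤ τ) :
    realZetaSum K τ ≤ realZetaSum K σ :=
  (hΛ.summable (hσ.trans_le h)).tsum_le_tsum (fun I ↦ Real.rpow_le_rpow_of_exponent_le
    (by exact_mod_cast one_le_absNorm I) (neg_le_neg h)) (hΛ.summable hσ)

lemma one_le_norm_dedekindZetaSum_mul (hΛ : IsCompletedDedekindZeta K ΛK) {s : ℂ}
    (hs : 1 < s.re) : 1 ≤ ‖dedekindZetaSum K s‖ * realZetaSum K s.re := by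
  have hs0 : -s ≠ 0 := fun h ↦ by rw [neg_eq_zero.mp h, zero_re] at hs; linarith
  let f : Ideal (𝓞 K) →*₀ ℂ :=
    { toFun := fun I ↦ (Ideal.absNorm I : ℂ) ^ (-s)
      map_zero' := by simp [hs0]
      map_one' := by simp
      map_mul' := fun I J ↦ by rw [map_mul, Nat.cast_mul, natCast_mul_natCast_cpow] }
  have hsupp : Function.support f ⊆ {I | I ≠ ⊥} := by
    rintro I hI rfl
    exact hI (by rw [← Ideal.zero_eq_bot, map_zero])
  have hsuppn : Function.support (fun I ↦ ‖f I‖) ⊆ {I | I ≠ ⊥} := by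
    rintro I hI rfl
    exact hI (by beta_reduce; rw [← Ideal.zero_eq_bot, map_zero, norm_zero])
  have hn (I : {I : Ideal (𝓞 K) // I ≠ ⊥}) : ‖f I.1‖ = (Ideal.absNorm I.1 : ℝ) ^ (-s.re) :=
    norm_absNorm_cpow I s
  have h1 : Summable fun I ↦ ‖f I‖ := by
    rw [← Set.indicator_eq_self.mpr hsuppn, ← summable_subtype_iff_indicator]
    exact (hΛ.summable hs).congr fun I ↦ (hn I).symm
  have h2 := one_le_norm_tsum_mul_tsum_norm f h1
  rw [← tsum_subtype_eq_of_support_subset hsupp, ← tsum_subtype_eq_of_support_subset hsuppn] at h2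
  refine h2.trans_eq ?_
  congr 1
  exact tsum_congr hn

end Zeta

lemma norm_Gamma_le {s : ℂ} (hs : 0 < s.re) : ‖Gamma s‖ ≤ Real.Gamma s.re := by
  rw [Gamma_eq_integral hs, Real.Gamma_eq_integral hs, GammaIntegral]
  refine (MeasureTheory.norm_integral_le_integral_norm _).trans_eq
    (MeasureTheory.setIntegral_congr_fun measurableSet_Ioi fun x (hx : 0 < x) ↦ ?_)
  rw [norm_mul, norm_cpow_eq_rpow_re_of_pos hx, norm_real, Real.norm_of_nonneg (Real.exp_pos _).le,
    sub_re, one_re]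

lemma norm_sin_le (z : ℂ) : ‖sin z‖ ≤ Real.exp ‖z‖ := by
  have h (w : ℂ) (hw : ‖w‖ = ‖z‖) : ‖exp w‖ ≤ Real.exp ‖z‖ := by
    rw [norm_exp]
    exact Real.exp_le_exp.mpr (hw ▸ re_le_norm w)
  have h1 := h (-z * I) (by simp)
  have h2 := h (z * I) (by simp)
  rw [sin, norm_div, norm_mul, norm_I, mul_one, norm_ofNat]
  linarith [norm_sub_le (exp (-z * I)) (exp (z * I))]

/-- A crude lower bound for `Γ` in the strip `1 ≤ re s ≤ 3`. -/
lemma exists_norm_Gamma_inv_le :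
    ∃ C : ℝ, ∀ s : ℂ, 1 < s.re → s.re ≤ 3 → 1 ≤ |s.im| →
      ‖(Gamma s)⁻¹‖ ≤ C * Real.exp (4 * ‖s‖) := by
  have hcont : ContinuousOn Real.Gamma (Set.Icc 1 3) := fun x hx ↦
    (Real.differentiableAt_Gamma fun m ↦ by
      have : 0 < x := by linarith [hx.1]
      have : (0 : ℝ) ≤ m := Nat.cast_nonneg m
      linarith).continuousAt.continuousWithinAt
  obtain ⟨C, hC⟩ := isCompact_Icc.exists_bound_of_continuousOn hcont
  refine ⟨C, fun s h1 h3 him ↦ ?_⟩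
  have him' (a : ℝ) : 1 ≤ ‖(a : ℂ) - s‖ := by
    refine him.trans ?_
    simpa using abs_im_le_norm ((a : ℂ) - s)
  have hne (a : ℝ) : (a : ℂ) - s ≠ 0 := norm_pos_iff.mp (one_pos.trans_le (him' a))
  have hG : Gamma (4 - s) = (3 - s) * (2 - s) * (1 - s) * Gamma (1 - s) := by
    have e1 := Gamma_add_one (1 - s) (by simpa using hne 1)
    have e2 := Gamma_add_one (2 - s) (by simpa using hne 2)
    have e3 := Gamma_add_one (3 - s) (by simpa using hne 3)
    rw [show 3 - s + 1 = 4 - s by ring] at e3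
    rw [show 2 - s + 1 = 3 - s by ring] at e2
    rw [show 1 - s + 1 = 2 - s by ring] at e1
    rw [e3, e2, e1]; ring
  have hG4 : ‖Gamma (4 - s)‖ ≤ C := by
    have hre : (4 - s).re = 4 - s.re := by simp
    refine (norm_Gamma_le (by rw [hre]; linarith)).trans ((le_abs_self _).trans (hC _ ?_))
    rw [hre]; constructor <;> linarith
  have hG1 : ‖Gamma (1 - s)‖ ≤ C := by
    refine le_trans ?_ hG4
    rw [hG, norm_mul, norm_mul, norm_mul]
    have a1 := him' 1
    have a2 := him' 2
    have a3 := him' 3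
    push_cast at a1 a2 a3
    refine le_mul_of_one_le_left (norm_nonneg _) ?_
    exact one_le_mul_of_one_le_of_one_le (one_le_mul_of_one_le_of_one_le a3 a2) a1
  have hrefl := Gamma_mul_Gamma_one_sub s
  have hG0 : Gamma s ≠ 0 := Gamma_ne_zero_of_re_pos (by linarith)
  have hG1' : Gamma (1 - s) ≠ 0 := by
    refine Gamma_ne_zero fun m h ↦ ?_
    have := congrArg im h
    simp only [sub_im, one_im, zero_sub, neg_im, natCast_im, neg_zero, neg_eq_zero] at this
    rw [this, abs_zero] at him
    linarith
  have hsin : sin (Real.pi * s) ≠ 0 := by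
    intro h
    rw [h, div_zero] at hrefl
    exact mul_ne_zero hG0 hG1' hrefl
  have hpi : (Real.pi : ℂ) ≠ 0 := ofReal_ne_zero.mpr Real.pi_ne_zero
  have hinv : (Gamma s)⁻¹ = Gamma (1 - s) * sin (Real.pi * s) / Real.pi := by
    rw [eq_div_iff hpi, inv_mul_eq_iff_eq_mul₀ hG0, ← mul_assoc, hrefl, div_mul_cancel₀ _ hsin]
  rw [hinv, norm_div, norm_mul, norm_real, Real.norm_of_nonneg Real.pi_pos.le]
  refine (div_le_self (by positivity) (by linarith [Real.pi_gt_three])).trans ?_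
  have hs4 : ‖sin (Real.pi * s)‖ ≤ Real.exp (4 * ‖s‖) := by
    refine (norm_sin_le _).trans (Real.exp_le_exp.mpr ?_)
    rw [norm_mul, norm_real, Real.norm_of_nonneg Real.pi_pos.le]
    exact mul_le_mul_of_nonneg_right Real.pi_le_four (norm_nonneg _)
  exact mul_le_mul hG1 hs4 (norm_nonneg _) ((norm_nonneg _).trans hG1)

section Ratio

variable {K : Type*} [Field K] [NumberField K] {ΛK : ℂ → ℂ} {ξK : ℂ → ℂ}

lemma xi_eq (hΛ : IsCompletedDedekindZeta K ΛK)
    (hξeq : ∀ s : ℂ, s ≠ 0 → s ≠ 1 → ξK s = s * (s - 1) * ΛK s) {s : ℂ} (hs : 1 < s.re) :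
    ξK s = s * (s - 1) * (((Real.sqrt |(NumberField.discr K : ℝ)| / (2 * Real.pi) : ℝ) : ℂ) ^ s *
      Gamma s * dedekindZetaSum K s) := by
  rw [hξeq s (by rintro rfl; simp at hs; linarith) (by rintro rfl; simp at hs),
    hΛ.eq_on_gt_one s hs]

lemma xi_ne_zero (hΛ : IsCompletedDedekindZeta K ΛK)
    (hξeq : ∀ s : ℂ, s ≠ 0 → s ≠ 1 → ξK s = s * (s - 1) * ΛK s) {s : ℂ} (hs : 1 < s.re) :
    ξK s ≠ 0 := by
  rw [xi_eq hΛ hξeq hs]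
  have h0 : s ≠ 0 := by rintro rfl; simp at hs; linarith
  have h1 : s - 1 ≠ 0 := sub_ne_zero.mpr (by rintro rfl; simp at hs)
  have hq := ofReal_ne_zero.mpr (sqrt_discr_div_pos K).ne'
  have hζ : dedekindZetaSum K s ≠ 0 := by
    intro h
    have := one_le_norm_dedekindZetaSum_mul hΛ hs
    rw [h, norm_zero, zero_mul] at this
    linarith
  have hG : Gamma s ≠ 0 := Gamma_ne_zero_of_re_pos (by linarith)
  have hqs := (cpow_ne_zero_iff_of_exponent_ne_zero h0).mpr hq
  exact mul_ne_zero (mul_ne_zero h0 h1) (mul_ne_zero (mul_ne_zero hqs hG) hζ)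

lemma exists_realZetaSum_le (hΛ : IsCompletedDedekindZeta K ΛK) (hξdiff : Differentiable ℂ ξK)
    (hξeq : ∀ s : ℂ, s ≠ 0 → s ≠ 1 → ξK s = s * (s - 1) * ΛK s) :
    ∃ C : ℝ, ∀ σ : ℝ, 1 < σ → σ ≤ 3 → realZetaSum K σ ≤ C / (σ - 1) := by
  set q : ℝ := Real.sqrt |(NumberField.discr K : ℝ)| / (2 * Real.pi) with hq
  have hq0 : 0 < q := sqrt_discr_div_pos K
  have hcont : ContinuousOn (fun σ : ℝ ↦ ξK σ / (σ * (q : ℂ) ^ (σ : ℂ) * Gamma σ))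
      (Set.Icc 1 3) := by
    have hq' : (q : ℂ) ≠ 0 := ofReal_ne_zero.mpr hq0.ne'
    intro x hx
    have hx0 : 0 < x := by linarith [hx.1]
    have hGx : Gamma x ≠ 0 := Gamma_ne_zero_of_re_pos (by simpa using hx0)
    have hxc : (x : ℂ) ≠ 0 := ofReal_ne_zero.mpr hx0.ne'
    have h1 : ContinuousAt (fun σ : ℝ ↦ Gamma σ) x := by
      refine ContinuousAt.comp (g := Gamma) ?_ continuous_ofReal.continuousAt
      refine (differentiableAt_Gamma _ fun m h ↦ ?_).continuousAt
      have := congrArg re h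
      simp only [ofReal_re, neg_re, natCast_re] at this
      have : (0 : ℝ) ≤ m := Nat.cast_nonneg m
      linarith
    have h2 : ContinuousAt (fun σ : ℝ ↦ (q : ℂ) ^ (σ : ℂ)) x :=
      continuous_ofReal.continuousAt.const_cpow (Or.inl hq')
    have h3 : ContinuousAt (fun σ : ℝ ↦ ξK σ) x :=
      (hξdiff.continuous.comp continuous_ofReal).continuousAt
    refine (h3.div ((continuous_ofReal.continuousAt.mul h2).mul h1) ?_).continuousWithinAt
    exact mul_ne_zero (mul_ne_zero hxc ((cpow_ne_zero_iff_of_exponent_ne_zero hxc).mpr hq')) hGx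
  obtain ⟨C, hC⟩ := isCompact_Icc.exists_bound_of_continuousOn hcont
  refine ⟨C, fun σ h1 h3 ↦ ?_⟩
  rw [le_div_iff₀ (by linarith)]
  refine le_trans (le_of_eq ?_) (hC σ ⟨h1.le, h3⟩)
  have hσ : (σ : ℂ) ≠ 0 := ofReal_ne_zero.mpr (by linarith)
  have hσ1 : (σ : ℂ) - 1 ≠ 0 := sub_ne_zero.mpr (by exact_mod_cast h1.ne')
  have hG : Gamma σ ≠ 0 := Gamma_ne_zero_of_re_pos (by simp; linarith)
  have hqs := (cpow_ne_zero_iff_of_exponent_ne_zero hσ).mpr (ofReal_ne_zero.mpr hq0.ne')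
  rw [xi_eq hΛ hξeq (by simpa using h1), ← hq, dedekindZetaSum_ofReal,
    show (σ : ℂ) * (σ - 1) * ((q : ℂ) ^ (σ : ℂ) * Gamma σ * realZetaSum K σ) /
      (σ * (q : ℂ) ^ (σ : ℂ) * Gamma σ) = ((realZetaSum K σ * (σ - 1) : ℝ) : ℂ) by
      push_cast; field_simp]
  rw [norm_real, Real.norm_of_nonneg]
  exact mul_nonneg (tsum_nonneg fun _ ↦ by positivity) (by linarith)

/-- Growth of `ξ_K(s-1) / ξ_K(s)` in the strip `1 < re s ≤ 3`. -/
lemma exists_norm_xi_div_le_of_re_le (hdeg : Module.finrank ℚ K = 2)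
    (himag : ∀ v : InfinitePlace K, v.IsComplex)
    (hclass : NumberField.classNumber K = 1) (hΛ : IsCompletedDedekindZeta K ΛK)
    (hξdiff : Differentiable ℂ ξK)
    (hξeq : ∀ s : ℂ, s ≠ 0 → s ≠ 1 → ξK s = s * (s - 1) * ΛK s) :
    ∃ A : ℝ, 0 ≤ A ∧ ∀ s : ℂ, 1 < s.re → s.re ≤ 3 → 1 ≤ |s.im| →
      ‖ξK (s - 1) / ξK s‖ ≤ A * Real.exp (5 * ‖s‖) / (s.re - 1) := by
  set q : ℝ := Real.sqrt |(NumberField.discr K : ℝ)| / (2 * Real.pi) with hq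
  have hq0 : 0 < q := sqrt_discr_div_pos K
  obtain ⟨M, hM⟩ := exists_norm_xi_le hdeg himag hclass hΛ hξdiff hξeq
  obtain ⟨C, hC⟩ := exists_norm_Gamma_inv_le
  obtain ⟨D, hD⟩ := exists_realZetaSum_le hΛ hξdiff hξeq
  have hcont : ContinuousOn (fun σ : ℝ ↦ q ^ (-σ)) (Set.Icc 1 3) :=
    (continuous_const.rpow continuous_neg fun _ ↦ Or.inl hq0.ne').continuousOn
  obtain ⟨E, hE⟩ := isCompact_Icc.exists_bound_of_continuousOn hcont
  have hM0 : 0 ≤ M := by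
    have := (norm_nonneg _).trans (hM 0 (by norm_num) (by norm_num))
    simpa using this
  have hbound {s : ℂ} (h1 : 1 < s.re) (h3 : s.re ≤ 3) (him : 1 ≤ |s.im|) :
      ‖ξK (s - 1) / ξK s‖ ≤
        (M * (4 * Real.exp ‖s‖)) * (E * (C * Real.exp (4 * ‖s‖)) * (D / (s.re - 1))) := by
    rw [div_eq_mul_inv, norm_mul]
    have hζ : ‖(dedekindZetaSum K s)⁻¹‖ ≤ D / (s.re - 1) := by
      refine le_trans ?_ (hD _ h1 h3)
      have := one_le_norm_dedekindZetaSum_mul hΛ h1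
      have hpos : 0 < ‖dedekindZetaSum K s‖ := by
        by_contra! h
        rw [le_antisymm h (norm_nonneg _), zero_mul] at this
        linarith
      rwa [norm_inv, inv_le_iff_one_le_mul₀' hpos]
    have hqs : ‖((q : ℂ) ^ s)⁻¹‖ ≤ E := by
      rw [norm_inv, norm_cpow_eq_rpow_re_of_pos hq0, ← Real.rpow_neg hq0.le]
      exact (le_abs_self _).trans (hE _ ⟨h1.le, h3⟩)
    have him1 : 1 ≤ ‖s‖ := him.trans (abs_im_le_norm s)
    have him2 : 1 ≤ ‖s - 1‖ := him.trans (by simpa using abs_im_le_norm (s - 1))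
    have hnum : ‖ξK (s - 1)‖ ≤ M * (4 * Real.exp ‖s‖) := by
      refine (hM _ (by simp; linarith) (by simp; linarith)).trans
        (mul_le_mul_of_nonneg_left ?_ hM0)
      have e1 : ‖s - 1‖ ≤ ‖s‖ + 1 := by simpa using norm_sub_le s 1
      have e2 : 1 + ‖s‖ / 2 ≤ Real.exp (‖s‖ / 2) := by
        linarith [Real.add_one_le_exp (‖s‖ / 2)]
      have e3 : Real.exp ‖s‖ = Real.exp (‖s‖ / 2) ^ 2 := by
        rw [← Real.exp_nat_mul]; congr 1; push_cast; ring
      rw [e3]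
      nlinarith [norm_nonneg (s - 1), norm_nonneg s]
    have hden : ‖(ξK s)⁻¹‖ ≤ E * (C * Real.exp (4 * ‖s‖)) * (D / (s.re - 1)) := by
      rw [xi_eq hΛ hξeq h1, ← hq, mul_inv, mul_inv, mul_inv, mul_inv, norm_mul, norm_mul, norm_mul,
        norm_mul, norm_inv s, norm_inv (s - 1)]
      have hE0 := (norm_nonneg _).trans hqs
      have hC0 := (norm_nonneg _).trans (hC s h1 h3 him)
      refine (mul_le_of_le_one_left (by positivity)
        (mul_le_one₀ (inv_le_one_of_one_le₀ him1) (by positivity)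
          (inv_le_one_of_one_le₀ him2))).trans ?_
      exact mul_le_mul (mul_le_mul hqs (hC s h1 h3 him) (norm_nonneg _) hE0) hζ (norm_nonneg _)
        (mul_nonneg hE0 hC0)
    exact mul_le_mul hnum hden (norm_nonneg _) (by positivity)
  refine ⟨|M * 4 * E * C * D|, abs_nonneg _, fun s h1 h3 him ↦ (hbound h1 h3 him).trans ?_⟩
  rw [show 5 * ‖s‖ = ‖s‖ + 4 * ‖s‖ by ring, Real.exp_add]
  have h0 : 0 ≤ Real.exp ‖s‖ * Real.exp (4 * ‖s‖) / (s.re - 1) :=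
    div_nonneg (by positivity) (by linarith)
  have := mul_le_mul_of_nonneg_right (le_abs_self (M * 4 * E * C * D)) h0
  refine (le_of_eq ?_).trans (this.trans (le_of_eq ?_)) <;> ring

/-- Boundedness of `ξ_K(s-1) / ξ_K(s)` for `3 ≤ re s`. -/
lemma exists_norm_xi_div_le_of_le_re (hΛ : IsCompletedDedekindZeta K ΛK)
    (hξeq : ∀ s : ℂ, s ≠ 0 → s ≠ 1 → ξK s = s * (s - 1) * ΛK s) :
    ∃ A : ℝ, 0 ≤ A ∧ ∀ s : ℂ, 3 ≤ s.re → ‖ξK (s - 1) / ξK s‖ ≤ A := by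
  set q : ℝ := Real.sqrt |(NumberField.discr K : ℝ)| / (2 * Real.pi) with hq
  have hq0 : 0 < q := sqrt_discr_div_pos K
  have hZ0 : 0 ≤ realZetaSum K 2 := tsum_nonneg fun _ ↦ by positivity
  refine ⟨q⁻¹ * realZetaSum K 2 * realZetaSum K 2, by positivity, fun s hs ↦ ?_⟩
  have h0 : s ≠ 0 := by rintro rfl; simp at hs; linarith
  have h1 : s - 1 ≠ 0 := sub_ne_zero.mpr (by rintro rfl; norm_num at hs)
  have hqc : (q : ℂ) ≠ 0 := ofReal_ne_zero.mpr hq0.ne'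
  have hqs := (cpow_ne_zero_iff_of_exponent_ne_zero h0).mpr hqc
  have hG : Gamma (s - 1) ≠ 0 := Gamma_ne_zero_of_re_pos (by simp; linarith)
  have hGs : Gamma s = (s - 1) * Gamma (s - 1) := by
    rw [← Gamma_add_one _ h1, sub_add_cancel]
  have hone := one_le_norm_dedekindZetaSum_mul hΛ (s := s) (by linarith)
  have hpos : 0 < ‖dedekindZetaSum K s‖ := by
    by_contra! h
    rw [le_antisymm h (norm_nonneg _), zero_mul] at hone
    linarith
  have hζ0 := norm_pos_iff.mp hpos
  have hre : (s - 1).re = s.re - 1 := by simp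
  have heq : ξK (s - 1) / ξK s =
      (s - 2) / s * (s - 1)⁻¹ * (q : ℂ)⁻¹ * dedekindZetaSum K (s - 1) *
        (dedekindZetaSum K s)⁻¹ := by
    rw [xi_eq hΛ hξeq (s := s) (by linarith), xi_eq hΛ hξeq (s := s - 1) (by linarith), ← hq, hGs,
      cpow_sub _ _ hqc, cpow_one]
    field_simp
    ring
  have b1 : ‖(s - 2) / s‖ ≤ 1 := by
    rw [norm_div, div_le_one (norm_pos_iff.mpr h0), ← sq_le_sq₀ (norm_nonneg _) (norm_nonneg _),
      ← normSq_eq_norm_sq, ← normSq_eq_norm_sq, normSq_apply, normSq_apply]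
    simp only [sub_re, sub_im, re_ofNat, im_ofNat]
    nlinarith
  have b2 : ‖(s - 1)⁻¹‖ ≤ 1 := by
    rw [norm_inv]
    refine inv_le_one_of_one_le₀ (le_trans ?_ (re_le_norm _))
    rw [hre]; linarith
  have b3 : ‖dedekindZetaSum K (s - 1)‖ ≤ realZetaSum K 2 :=
    (norm_dedekindZetaSum_le hΛ (by rw [hre]; linarith)).trans
      (realZetaSum_anti hΛ one_lt_two (by rw [hre]; linarith))
  have b4 : ‖(dedekindZetaSum K s)⁻¹‖ ≤ realZetaSum K 2 := by
    refine le_trans ?_ (realZetaSum_anti hΛ one_lt_two (by linarith : 2 ≤ s.re))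
    rwa [norm_inv, inv_le_iff_one_le_mul₀' hpos]
  rw [heq, norm_mul, norm_mul, norm_mul, norm_mul, norm_inv (q : ℂ), norm_real,
    Real.norm_of_nonneg hq0.le]
  gcongr
  exact mul_le_of_le_one_left (inv_nonneg.mpr hq0.le) (mul_le_one₀ b1 (norm_nonneg _) b2)

end Ratio

section PhragmenLindelof

open ComplexConjugate Topology

lemma exists_tendsto_div_of_re_eq_one {ξ : ℂ → ℂ} (hd : Differentiable ℂ ξ)
    (hfe : ∀ s, ξ (1 - s) = ξ s) (hconj : ∀ s, ξ (conj s) = conj (ξ s)) (h0 : ∃ s, ξ s ≠ 0)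
    {z : ℂ} (hz : z.re = 1) :
    ∃ y : ℂ, ‖y‖ = 1 ∧ Tendsto (fun s ↦ ξ (s - 1) / ξ s) (𝓝[≠] z) (𝓝 y) := by
  have han : AnalyticOnNhd ℂ ξ Set.univ := hd.differentiableOn.analyticOnNhd isOpen_univ
  have hne : ¬ ∀ᶠ w in 𝓝 z, ξ w = 0 := by
    intro h
    obtain ⟨s, hs⟩ := h0
    exact hs (congrFun (han.eq_of_eventuallyEq (g := 0) (fun _ _ ↦ analyticAt_const) h) s)
  obtain ⟨n, g, hg, hgz, heq⟩ :=
    (han z trivial).exists_eventuallyEq_pow_smul_nonzero_iff.mpr hne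
  have hzc : 2 - conj z = z := by
    apply Complex.ext <;> simp [hz]; norm_num
  have hrefl (s : ℂ) : ξ (s - 1) = conj (ξ (2 - conj s)) := by
    rw [← hconj, ← hfe]
    congr 1
    rw [map_sub, conj_conj, conj_ofNat]; ring
  have hcts : Continuous fun s : ℂ ↦ 2 - conj s := continuous_const.sub continuous_conj
  have htend : Tendsto (fun s : ℂ ↦ 2 - conj s) (𝓝 z) (𝓝 z) := hcts.tendsto' z z hzc
  refine ⟨(-1) ^ n * conj (g z) / g z, ?_, ?_⟩
  · rw [norm_div, norm_mul, norm_pow, norm_neg, norm_one, one_pow, one_mul, norm_conj,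
      div_self (norm_ne_zero_iff.mpr hgz)]
  have hlim : Tendsto (fun s ↦ (-1) ^ n * conj (g (2 - conj s)) / g s) (𝓝 z)
      (𝓝 ((-1) ^ n * conj (g z) / g z)) := by
    refine Tendsto.div (tendsto_const_nhds.mul ?_) hg.continuousAt hgz
    exact (continuous_conj.tendsto _).comp (hg.continuousAt.tendsto.comp htend)
  refine (hlim.mono_left nhdsWithin_le_nhds).congr' ?_
  filter_upwards [nhdsWithin_le_nhds heq, nhdsWithin_le_nhds (htend.eventually heq),
    self_mem_nhdsWithin] with s h1 h2 (hs : s ≠ z)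
  have hsz : (s - z) ^ n ≠ 0 := pow_ne_zero _ (sub_ne_zero.mpr hs)
  have h3 : conj (2 - conj s - z) = -1 * (s - z) := by
    conv_lhs => rw [← hzc]
    simp only [map_sub, conj_conj, conj_ofNat]
    ring
  rw [hrefl, h1, h2, smul_eq_mul, smul_eq_mul, map_mul, map_pow, h3, mul_pow]
  field_simp

/-- A function on `1 ≤ re s` of modulus `1` on the boundary line and `O(1 / (re s - 1))` on a
half circle is bounded at points facing its center. -/
lemma norm_le_of_half_disc {Q : ℂ → ℂ} (hc : ContinuousOn Q {s | 1 ≤ s.re})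
    (hd : DifferentiableOn ℂ Q {s | 1 < s.re}) (h1 : ∀ s : ℂ, s.re = 1 → ‖Q s‖ ≤ 1) {t A : ℝ}
    (hA0 : 0 ≤ A) (hA : ∀ s : ℂ, 1 < s.re → ‖s - (1 + t * I)‖ = 1 → ‖Q s‖ ≤ A / (s.re - 1))
    {s : ℂ} (hs : 1 < s.re) (hs2 : s.re < 2) (ht : s.im = t) : ‖Q s‖ ≤ 2 * A + 1 := by
  set z : ℂ := 1 + t * I with hz
  have hzre : z.re = 1 := by simp [hz]
  have hzim : z.im = t := by simp [hz]
  set U : Set ℂ := {w | ‖w - z‖ < 1} ∩ {w | 1 < w.re} with hU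
  have hcl : closure U ⊆ {w | ‖w - z‖ ≤ 1} ∩ {w | 1 ≤ w.re} :=
    closure_minimal (fun w hw ↦ ⟨(show ‖w - z‖ < 1 from hw.1).le, (show 1 < w.re from hw.2).le⟩)
      ((isClosed_le (by fun_prop) continuous_const).inter
        (isClosed_le continuous_const continuous_re))
  have hUo : IsOpen U := (isOpen_lt (by fun_prop) continuous_const).inter
    (isOpen_lt continuous_const continuous_re)
  have hbdd : Bornology.IsBounded U := by
    refine (Metric.isBounded_ball (x := z) (r := 1)).subset fun w hw ↦ ?_
    rw [Metric.mem_ball, dist_eq_norm]; exact hw.1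
  have hcoord (w : ℂ) : ‖w - z‖ ^ 2 = (w.re - 1) ^ 2 + (w.im - t) ^ 2 := by
    rw [← normSq_eq_norm_sq, normSq_apply, sub_re, sub_im, hzre, hzim]; ring
  have hfac (w : ℂ) : ‖(w - z) ^ 2 + 1‖ ^ 2 =
      ((w.re - 1) ^ 2 - (w.im - t) ^ 2 + 1) ^ 2 + (2 * (w.re - 1) * (w.im - t)) ^ 2 := by
    rw [← normSq_eq_norm_sq, normSq_apply]
    simp only [pow_two, add_re, add_im, mul_re, mul_im, sub_re, sub_im, hzre, hzim, one_re, one_im]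
    ring
  have key : ‖Q s * ((s - z) ^ 2 + 1)‖ ≤ 2 * A + 1 := by
    refine norm_le_of_forall_mem_frontier_norm_le (f := fun w ↦ Q w * ((w - z) ^ 2 + 1)) hbdd
      ⟨?_, ?_⟩ (fun w hw ↦ ?_) (subset_closure ⟨?_, hs⟩)
    · exact (hd.mono fun w hw ↦ hw.2).mul (by fun_prop)
    · exact (hc.mono fun w hw ↦ (hcl hw).2).mul (by fun_prop)
    · rw [hUo.frontier_eq] at hw
      obtain ⟨hw1, hw2⟩ := hcl hw.1
      replace hw1 : ‖w - z‖ ≤ 1 := hw1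
      replace hw2 : 1 ≤ w.re := hw2
      have hsq := hcoord w
      have hfw := hfac w
      rw [norm_mul]
      rcases hw2.eq_or_lt with h | h
      · have hn : ‖(w - z) ^ 2 + 1‖ ≤ 1 := by
          rw [← abs_of_nonneg (norm_nonneg ((w - z) ^ 2 + 1)), ← sq_le_one_iff_abs_le_one, hfw, ← h]
          have : (w.im - t) ^ 2 ≤ 1 := by rw [← h] at hsq; nlinarith [norm_nonneg (w - z)]
          nlinarith [sq_nonneg (w.im - t)]
        exact (mul_le_one₀ (h1 w h.symm) (norm_nonneg _) hn).trans (by linarith)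
      · have h1' : ‖w - z‖ = 1 := le_antisymm hw1 (not_lt.mp fun h' ↦ hw.2 ⟨h', h⟩)
        have hn : ‖(w - z) ^ 2 + 1‖ = 2 * (w.re - 1) := by
          rw [← sq_eq_sq₀ (norm_nonneg _) (by linarith), hfw]
          rw [h1'] at hsq
          have : (w.im - t) ^ 2 = 1 - (w.re - 1) ^ 2 := by linarith
          rw [mul_pow, this]; ring
        rw [hn]
        calc ‖Q w‖ * (2 * (w.re - 1)) ≤ A / (w.re - 1) * (2 * (w.re - 1)) :=
              mul_le_mul_of_nonneg_right (hA w h h1') (by linarith)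
          _ = 2 * A := by field_simp [(sub_pos.mpr h).ne']
          _ ≤ 2 * A + 1 := by linarith
    · change ‖s - z‖ < 1
      have := hcoord s
      rw [ht, sub_self] at this
      rw [← abs_of_nonneg (norm_nonneg (s - z)), ← sq_lt_one_iff_abs_lt_one, this]
      nlinarith
  refine le_trans ?_ key
  rw [norm_mul]
  refine le_mul_of_one_le_right (norm_nonneg _) ?_
  rw [← abs_of_nonneg (norm_nonneg ((s - z) ^ 2 + 1)), ← one_le_sq_iff_one_le_abs, hfac, ht,
    sub_self]
  nlinarith [sq_nonneg (s.re - 1), sq_nonneg ((s.re - 1) ^ 2)]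

/-- A Phragmén–Lindelöf argument comparing `ξ (s - 1)` with `ξ s` to the right of `re s = 1`. -/
lemma norm_sub_one_le_norm {ξ : ℂ → ℂ} (hd : Differentiable ℂ ξ)
    (hfe : ∀ s, ξ (1 - s) = ξ s) (hconj : ∀ s, ξ (conj s) = conj (ξ s))
    (h0 : ∀ s : ℂ, 1 < s.re → ξ s ≠ 0) {A B : ℝ} (hA0 : 0 ≤ A) (hB0 : 0 ≤ B)
    (hA : ∀ s : ℂ, 1 < s.re → s.re ≤ 3 → 1 ≤ |s.im| →
      ‖ξ (s - 1) / ξ s‖ ≤ A * Real.exp (5 * ‖s‖) / (s.re - 1))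
    (hB : ∀ s : ℂ, 3 ≤ s.re → ‖ξ (s - 1) / ξ s‖ ≤ B) {s : ℂ} (hs : 1 < s.re) :
    ‖ξ (s - 1)‖ ≤ ‖ξ s‖ := by
  set H : Set ℂ := {s | 1 < s.re} with hH
  set q : ℂ → ℂ := fun s ↦ ξ (s - 1) / ξ s with hq
  have hHo : IsOpen H := isOpen_lt continuous_const continuous_re
  have hcl : closure H = {s | 1 ≤ s.re} := closure_setOfPred_lt_re 1
  have hqd : DifferentiableOn ℂ q H := fun w hw ↦ by
    have : DifferentiableAt ℂ (fun s ↦ ξ (s - 1)) w := by fun_prop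
    exact (this.div (hd w) (h0 w hw)).differentiableWithinAt
  have hbdry {z : ℂ} (hz : z.re = 1) : ∃ y : ℂ, ‖y‖ = 1 ∧ Tendsto q (𝓝[H] z) (𝓝 y) := by
    obtain ⟨y, hy, hlim⟩ := exists_tendsto_div_of_re_eq_one hd hfe hconj
      ⟨2, h0 2 (by norm_num)⟩ hz
    refine ⟨y, hy, hlim.mono_left (nhdsWithin_mono _ fun w (hw : 1 < w.re) ↦ ?_)⟩
    rintro rfl
    exact hw.ne' hz
  set Q : ℂ → ℂ := extendFrom H q with hQ
  have hQq {w : ℂ} (hw : 1 < w.re) : Q w = q w := extendFrom_extends hqd.continuousOn w hw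
  have hQc : ContinuousOn Q {s | 1 ≤ s.re} := by
    refine continuousOn_extendFrom hcl.ge fun w (hw : 1 ≤ w.re) ↦ ?_
    rcases hw.eq_or_lt with h | h
    · obtain ⟨y, -, hy⟩ := hbdry h.symm
      exact ⟨y, hy⟩
    · exact ⟨q w, hqd.continuousOn w h⟩
  have hQd : DifferentiableOn ℂ Q H := hqd.congr fun w hw ↦ hQq hw
  have hQ1 {w : ℂ} (hw : w.re = 1) : ‖Q w‖ ≤ 1 := by
    obtain ⟨y, hy, hlim⟩ := hbdry hw
    rw [hQ, extendFrom_eq (hcl ▸ hw.ge) hlim, hy]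
  have hgrowth {w : ℂ} (hw : 1 < w.re) (hw5 : 5 ≤ ‖w‖) :
      ‖Q w‖ ≤ (2 * A * Real.exp 5 + B + 1) * Real.exp (5 * ‖w‖) := by
    have he : 1 ≤ Real.exp (5 * ‖w‖) := Real.one_le_exp (by positivity)
    have he5 : 1 ≤ Real.exp 5 := Real.one_le_exp (by norm_num)
    rcases le_total 3 w.re with h3 | h3
    · rw [hQq hw]
      refine (hB w h3).trans ?_
      have : 0 ≤ 2 * A * Real.exp 5 := by positivity
      nlinarith
    have him : 2 ≤ |w.im| := by
      have h1 := norm_le_abs_re_add_abs_im w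
      rw [abs_of_pos (by linarith)] at h1
      linarith
    rcases le_or_gt 2 w.re with h2 | h2
    · rw [hQq hw]
      refine (hA w hw h3 (by linarith)).trans ((div_le_self (by positivity) (by linarith)).trans ?_)
      refine mul_le_mul_of_nonneg_right ?_ (by positivity)
      nlinarith
    · refine (norm_le_of_half_disc hQc hQd (fun _ h ↦ hQ1 h) (t := w.im)
        (A := A * Real.exp (5 * (‖w‖ + 1))) (by positivity) (fun u hu hu1 ↦ ?_) hw h2 rfl).trans ?_
      · have hdist : ‖u - (1 + w.im * I)‖ = 1 := hu1
        have h4 := abs_re_le_norm (u - (1 + w.im * I))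
        have h5 := abs_im_le_norm (u - (1 + w.im * I))
        rw [hdist] at h4 h5
        simp only [sub_re, add_re, one_re, mul_re, ofReal_re, I_re, mul_zero, ofReal_im, I_im,
          mul_one, sub_zero, add_zero, sub_im, add_im, one_im, mul_im, zero_add] at h4 h5
        rw [hQq hu]
        refine (hA u hu (by linarith [(abs_le.mp h4).2]) ?_).trans ?_
        · have := abs_sub_abs_le_abs_sub w.im u.im
          rw [abs_sub_comm] at this
          linarith
        · refine div_le_div_of_nonneg_right (mul_le_mul_of_nonneg_left
            (Real.exp_le_exp.mpr ?_) hA0) (by linarith)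
          have h6 : ‖(1 : ℂ) + w.im * I‖ ≤ ‖w‖ := by
            rw [← sq_le_sq₀ (norm_nonneg _) (norm_nonneg _), ← normSq_eq_norm_sq,
              ← normSq_eq_norm_sq, normSq_apply, normSq_apply]
            simp
            nlinarith
          have h7 := norm_add_le (u - (1 + w.im * I)) (1 + w.im * I)
          rw [sub_add_cancel, hdist] at h7
          linarith
      · rw [mul_add, Real.exp_add, mul_one]
        nlinarith [mul_nonneg hB0 (Real.exp_pos (5 * ‖w‖)).le]
  have hPL : ‖Q (s - 1 + 1)‖ ≤ 1 := by
    refine PhragmenLindelof.right_half_plane_of_bounded_on_real (f := fun z ↦ Q (z + 1)) (C := 1)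
      ⟨?_, ?_⟩ ⟨1, one_lt_two, 5, ?_⟩ ?_ (fun x ↦ hQ1 (by simp)) (z := s - 1) ?_
    · exact hQd.comp (by fun_prop) fun z (hz : 0 < z.re) ↦ by simpa [hH] using hz
    · rw [closure_setOfPred_lt_re]
      exact hQc.comp (by fun_prop) fun z (hz : 0 ≤ z.re) ↦ by simpa using hz
    · refine Asymptotics.IsBigO.of_bound ((2 * A * Real.exp 5 + B + 1) * Real.exp 5) ?_
      rw [eventually_inf_principal]
      filter_upwards [tendsto_norm_cobounded_atTop.eventually_ge_atTop 6] with z hz hre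
      replace hre : 0 < z.re := hre
      have h1 : ‖z + 1‖ ≤ ‖z‖ + 1 := by simpa using norm_add_le z 1
      have h2 : ‖z‖ - 1 ≤ ‖z + 1‖ := by simpa using norm_sub_norm_le z (-1)
      refine (hgrowth (by simpa using hre) (by linarith)).trans ?_
      rw [Real.rpow_one, Real.norm_of_nonneg (Real.exp_pos _).le, mul_assoc _ (Real.exp 5),
        ← Real.exp_add]
      gcongr
      linarith
    · refine ⟨B, ?_⟩
      rw [eventually_map]
      filter_upwards [eventually_ge_atTop 2] with x hx
      have : (3 : ℝ) ≤ ((x : ℂ) + 1).re := by simp; linarith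
      rw [hQq (by linarith)]
      exact hB _ this
    · simp; linarith
  rw [sub_add_cancel, hQq hs, hq] at hPL
  rwa [norm_div, div_le_one (norm_pos_iff.mpr (h0 s hs))] at hPL

end PhragmenLindelof

/-- A holomorphic self-map of the half-plane `1 < re s` with a fixed point `ρ` is the identity as
soon as it has derivative `1` at `ρ` or another fixed point. -/
lemma eq_self_of_mapsTo_halfPlane {U : ℂ → ℂ} (hd : DifferentiableOn ℂ U {s | 1 < s.re})
    (hU : ∀ s : ℂ, 1 < s.re → 1 < (U s).re) {ρ : ℝ} (hρ : 1 < ρ) (hfix : U ρ = ρ)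
    (h : deriv U ρ = 1 ∨ ∃ s : ℂ, 1 < s.re ∧ s ≠ ρ ∧ U s = s) {s : ℂ} (hs : 1 < s.re) :
    U s = s := by
  set c : ℝ := ρ - 1 with hc
  have hc0 : 0 < c := sub_pos.mpr hρ
  have hcc : (c : ℂ) ≠ 0 := ofReal_ne_zero.mpr hc0.ne'
  have hρc : (ρ : ℂ) = 1 + c := by rw [hc]; push_cast; ring
  set φ : ℂ → ℂ := fun z ↦ 1 + c * (1 + z) / (1 - z) with hφ
  set B : ℂ → ℂ := fun s ↦ (s - 1 - c) / (s - 1 + c) with hB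
  have hden {s : ℂ} (hs : 1 < s.re) : s - 1 + c ≠ 0 := fun h ↦ by
    have := congrArg re h
    simp at this
    linarith
  have hdenz {z : ℂ} (hz : ‖z‖ < 1) : 1 - z ≠ 0 := fun h ↦ by
    rw [← sub_eq_zero.mp h, norm_one] at hz
    exact lt_irrefl _ hz
  have hφmem {z : ℂ} (hz : ‖z‖ < 1) : 1 < (φ z).re := by
    have h1 : 0 < normSq (1 - z) := normSq_pos.mpr (hdenz hz)
    have h2 : normSq z < 1 := by
      rw [normSq_eq_norm_sq]
      exact pow_lt_one₀ (norm_nonneg _) hz two_ne_zero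
    have h3 : (φ z).re = 1 + c * (1 - normSq z) / normSq (1 - z) := by
      simp only [hφ, add_re, one_re, div_re, mul_re, mul_im, ofReal_re, ofReal_im, add_im, one_im,
        sub_re, sub_im, normSq_apply z]
      ring
    rw [h3]
    have : 0 < c * (1 - normSq z) / normSq (1 - z) :=
      div_pos (mul_pos hc0 (by linarith)) h1
    linarith
  have hBmem {s : ℂ} (hs : 1 < s.re) : ‖B s‖ < 1 := by
    rw [hB, norm_div, div_lt_one (norm_pos_iff.mpr (hden hs)),
      ← sq_lt_sq₀ (norm_nonneg _) (norm_nonneg _), ← normSq_eq_norm_sq, ← normSq_eq_norm_sq,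
      normSq_apply, normSq_apply]
    simp
    nlinarith
  have hφB {s : ℂ} (hs : 1 < s.re) : φ (B s) = s := by
    have h1 := hdenz (hBmem hs)
    have h2 := hden hs
    simp only [hφ, hB] at h1 ⊢
    have h3 : 1 - (s - 1 - c) / (s - 1 + c) = 2 * c / (s - 1 + c) := by field_simp; ring
    rw [h3]
    field_simp
    ring
  have hBφ {z : ℂ} (hz : ‖z‖ < 1) : B (φ z) = z := by
    have h1 := hdenz hz
    have h2 := hden (hφmem hz)
    simp only [hφ, hB] at h2 ⊢
    rw [div_eq_iff h2]
    field_simp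
    ring
  have hφ0 : φ 0 = ρ := by simp [hφ, hρc]
  have hBρ : B ρ = 0 := by simp [hB, hρc]
  set F : ℂ → ℂ := B ∘ U ∘ φ with hF
  have hF0 : F 0 = 0 := by simp only [hF, Function.comp_apply]; rw [hφ0, hfix, hBρ]
  have hφd : DifferentiableOn ℂ φ (Metric.ball 0 1) := fun z hz ↦ by
    have := hdenz (mem_ball_zero_iff.mp hz)
    have h1 : DifferentiableAt ℂ (fun z : ℂ ↦ (c : ℂ) * (1 + z)) z := by fun_prop
    have h2 : DifferentiableAt ℂ (fun z : ℂ ↦ 1 - z) z := by fun_prop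
    exact ((h1.fun_div h2 this).const_add 1).differentiableWithinAt
  have hBd : DifferentiableOn ℂ B {s | 1 < s.re} := fun s hs ↦ by
    have h1 : DifferentiableAt ℂ (fun s : ℂ ↦ s - 1 - c) s := by fun_prop
    have h2 : DifferentiableAt ℂ (fun s : ℂ ↦ s - 1 + c) s := by fun_prop
    exact (h1.fun_div h2 (hden hs)).differentiableWithinAt
  have hFd : DifferentiableOn ℂ F (Metric.ball 0 1) :=
    hBd.comp (hd.comp hφd fun z hz ↦ hφmem (mem_ball_zero_iff.mp hz))
      fun z hz ↦ hU _ (hφmem (mem_ball_zero_iff.mp hz))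
  have hFmaps : Set.MapsTo F (Metric.ball 0 1) (Metric.closedBall (F 0) 1) := fun z hz ↦ by
    rw [hF0, mem_closedBall_zero_iff]
    exact (hBmem (hU _ (hφmem (mem_ball_zero_iff.mp hz)))).le
  have hslope : ∃ z ∈ Metric.ball (0 : ℂ) 1, dslope F 0 z = 1 := by
    rcases h with h | ⟨s, hs, hsρ, hUs⟩
    · refine ⟨0, Metric.mem_ball_self one_pos, ?_⟩
      have hopen : IsOpen {s : ℂ | 1 < s.re} := isOpen_lt continuous_const continuous_re
      have hρmem : {s : ℂ | 1 < s.re} ∈ nhds (ρ : ℂ) := hopen.mem_nhds (by simpa using hρ)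
      have hball : Metric.ball (0 : ℂ) 1 ∈ nhds (0 : ℂ) := Metric.ball_mem_nhds _ one_pos
      have d1 := (hφd.differentiableAt hball).hasDerivAt
      have d2 := (hd.differentiableAt hρmem).hasDerivAt
      have d3 := (hBd.differentiableAt hρmem).hasDerivAt
      have d4 : deriv B ρ * deriv φ 0 = 1 := by
        have e1 : HasDerivAt (B ∘ φ) (deriv B ρ * deriv φ 0) 0 :=
          HasDerivAt.comp 0 (by rwa [hφ0]) d1
        refine (e1.congr_of_eventuallyEq ?_).unique (hasDerivAt_id 0)
        filter_upwards [hball] with z hz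
        exact (hBφ (mem_ball_zero_iff.mp hz)).symm
      rw [dslope_same]
      have d5 : HasDerivAt (U ∘ φ) (deriv U ρ * deriv φ 0) 0 :=
        HasDerivAt.comp 0 (by rwa [hφ0]) d1
      have d6 : HasDerivAt F (deriv B ρ * (deriv U ρ * deriv φ 0)) 0 :=
        HasDerivAt.comp 0 (by rwa [Function.comp_apply, hφ0, hfix]) d5
      rw [d6.deriv, h, one_mul, d4]
    · have hBs : B s ≠ 0 := fun h0 ↦ hsρ (by rw [← hφB hs, h0, hφ0])
      refine ⟨B s, mem_ball_zero_iff.mpr (hBmem hs), ?_⟩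
      have hFs : F (B s) = B s := by
        simp only [hF, Function.comp_apply]
        rw [hφB hs, hUs]
      rw [dslope_of_ne _ hBs, slope_def_field, hFs, hF0, sub_zero, div_self hBs]
  obtain ⟨z, hz, hz1⟩ := hslope
  have haff := affine_of_mapsTo_ball_of_norm_dslope_eq_div hFd hFmaps hz
    (by rw [hz1, norm_one, div_one]) (mem_ball_zero_iff.mpr (hBmem hs))
  simp only [hF0, hz1, zero_add, sub_zero, smul_eq_mul, mul_one] at haff
  rw [hF, Function.comp_apply, Function.comp_apply, hφB hs] at haff
  rw [← hφB (hU s hs), haff, hφB hs]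

section Final

open ComplexConjugate Topology

variable {K : Type*} [Field K] [NumberField K] {ΛK : ℂ → ℂ} {ξK : ℂ → ℂ}

lemma xi_one_ne_zero (hΛ : IsCompletedDedekindZeta K ΛK) (hξdiff : Differentiable ℂ ξK)
    (hξeq : ∀ s : ℂ, s ≠ 0 → s ≠ 1 → ξK s = s * (s - 1) * ΛK s) : ξK 1 ≠ 0 := by
  obtain ⟨r, hr, hlim⟩ := hΛ.simple_pole_at_one
  have h1 : Tendsto ξK (𝓝[≠] 1) (𝓝 (ξK 1)) :=
    (hξdiff.continuous.tendsto 1).mono_left nhdsWithin_le_nhds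
  have h2 : Tendsto ξK (𝓝[≠] 1) (𝓝 (1 * r)) := by
    refine ((tendsto_id.mono_left nhdsWithin_le_nhds).mul hlim).congr' ?_
    filter_upwards [self_mem_nhdsWithin,
      nhdsWithin_le_nhds (isOpen_ne.mem_nhds (one_ne_zero (α := ℂ)))] with s hs hs0
    rw [hξeq s hs0 hs, id, mul_assoc]
  rwa [tendsto_nhds_unique h1 h2, one_mul]

lemma phiK_two_sub (hΛ : IsCompletedDedekindZeta K ΛK) (a : ℝ) (s : ℂ) :
    phiK ΛK a (2 - s) = phiK ΛK a s := by
  rw [phiK, phiK, hΛ.functional_equation (2 - s), hΛ.functional_equation (2 - s - 1)]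
  ring_nf

lemma deriv_phiK_two_sub (hΛ : IsCompletedDedekindZeta K ΛK) (a : ℝ) (s : ℂ) :
    deriv (phiK ΛK a) (2 - s) = -deriv (phiK ΛK a) s := by
  have h := deriv_comp_const_sub (f := phiK ΛK a) (a := 2) (x := s)
  simp only [phiK_two_sub hΛ] at h
  rw [show (fun x ↦ phiK ΛK a x) = phiK ΛK a from rfl] at h
  rw [h, neg_neg]

lemma mul_phiK (hξeq : ∀ s : ℂ, s ≠ 0 → s ≠ 1 → ξK s = s * (s - 1) * ΛK s) (a : ℝ) {s : ℂ}
    (h0 : s ≠ 0) (h1 : s ≠ 1) (h2 : s ≠ 2) :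
    s * (s - 1) * (s - 2) * phiK ΛK a s =
      (a : ℂ) ^ s * ξK s * (s - 2) + (a : ℂ) ^ (2 - s) * ξK (s - 1) * s := by
  rw [phiK, hξeq s h0 h1, hξeq (s - 1) (sub_ne_zero.mpr h1) (fun h ↦ h2 (by linear_combination h))]
  ring

/-- Existence of a real zero of `φ_K(a, ·)` between `1` and `2`. -/
lemma exists_phiK_eq_zero (hΛ : IsCompletedDedekindZeta K ΛK) (hξdiff : Differentiable ℂ ξK)
    (hξeq : ∀ s : ℂ, s ≠ 0 → s ≠ 1 → ξK s = s * (s - 1) * ΛK s)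
    {r : ℝ} (hr : (r : ℂ) = deriv ξK 0 / ξK 0) {a : ℝ} (ha0 : 0 < a) (ha : 1 + r < Real.log a) :
    ∃ ρ ∈ Set.Ioo (1 : ℝ) 2, phiK ΛK a ρ = 0 := by
  have hac : (a : ℂ) ≠ 0 := ofReal_ne_zero.mpr ha0.ne'
  have hR := xi_one_ne_zero hΛ hξdiff hξeq
  have h01 : ξK 0 = ξK 1 := by rw [← xi_one_sub hΛ hξdiff hξeq 0, sub_zero]
  rw [h01, eq_div_iff hR] at hr
  have hd1 : deriv ξK 1 = -deriv ξK 0 := by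
    have h := deriv_comp_const_sub (f := ξK) (a := 1) (x := 0)
    simp only [xi_one_sub hΛ hξdiff hξeq, sub_zero] at h
    rw [show (fun x ↦ ξK x) = ξK from rfl] at h
    rw [h, neg_neg]
  set f : ℂ → ℂ := fun s ↦
    ((a : ℂ) ^ s * ξK s * (s - 2) + (a : ℂ) ^ (2 - s) * ξK (s - 1) * s) / ξK 1 with hf
  have hf1 : f 1 = 0 := by
    simp only [hf, sub_self, h01, show (2 : ℂ) - 1 = 1 by norm_num]
    ring
  have hf2 : f 2 = 2 := by
    simp only [hf, sub_self, cpow_zero, show (2 : ℂ) - 1 = 1 by norm_num]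
    field_simp
    ring
  have hfd : Differentiable ℂ f := by
    have h1 : Differentiable ℂ fun s : ℂ ↦ (a : ℂ) ^ s := fun s ↦
      differentiableAt_id.const_cpow (Or.inl hac)
    have h2 : Differentiable ℂ fun s : ℂ ↦ (a : ℂ) ^ (2 - s) := fun s ↦
      (differentiableAt_id.const_sub 2).const_cpow (Or.inl hac)
    fun_prop
  have hderiv : HasDerivAt f ((2 * a * (1 + r - Real.log a) : ℝ) : ℂ) 1 := by
    have e1 : HasDerivAt (fun s : ℂ ↦ (a : ℂ) ^ s) (a * Real.log a) 1 := by
      have := (hasDerivAt_id (1 : ℂ)).const_cpow (c := (a : ℂ)) (Or.inl hac)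
      rwa [id, cpow_one, mul_one, ← ofReal_log ha0.le] at this
    have e2 : HasDerivAt (fun s : ℂ ↦ (a : ℂ) ^ (2 - s)) (-(a * Real.log a)) 1 := by
      have := ((hasDerivAt_id (1 : ℂ)).const_sub 2).const_cpow (c := (a : ℂ)) (Or.inl hac)
      rwa [id, show (2 : ℂ) - 1 = 1 by norm_num, cpow_one, mul_neg_one, ← ofReal_log ha0.le] at this
    have e3 : HasDerivAt (fun s : ℂ ↦ ξK (s - 1)) (deriv ξK 0) 1 := by
      have := HasDerivAt.comp_sub_const (f := ξK) (1 : ℂ) 1 (hξdiff _).hasDerivAt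
      rwa [sub_self] at this
    refine ((((e1.mul (hξdiff 1).hasDerivAt).mul ((hasDerivAt_id (1 : ℂ)).sub_const 2)).add
      ((e2.mul e3).mul (hasDerivAt_id (1 : ℂ)))).div_const (ξK 1)).congr_deriv ?_
    simp only [Pi.mul_apply, id, hd1, ← hr, sub_self, h01, show (2 : ℂ) - 1 = 1 by norm_num,
      cpow_one]
    push_cast
    field_simp
    ring
  have hreal (x : ℝ) : f x = ((f x).re : ℂ) := by
    refine (conj_eq_iff_re.mp ?_).symm
    have hpow (w : ℂ) : conj ((a : ℂ) ^ w) = (a : ℂ) ^ conj w := by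
      rw [cpow_conj _ _ (by rw [arg_ofReal_of_nonneg ha0.le]; exact Real.pi_pos.ne), conj_ofReal]
    have h1 : conj (ξK 1) = ξK 1 := by rw [← xi_conj hΛ hξdiff hξeq, map_one]
    simp only [hf, map_div₀, map_add, map_mul, hpow, ← xi_conj hΛ hξdiff hξeq, map_sub, conj_ofReal,
      conj_ofNat, map_one]
  set g : ℝ → ℝ := fun x ↦ (f x).re with hg
  have hgc : Continuous g := continuous_re.comp (hfd.continuous.comp continuous_ofReal)
  have hgd : HasDerivAt g (2 * a * (1 + r - Real.log a)) 1 := by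
    have : HasDerivAt f ((2 * a * (1 + r - Real.log a) : ℝ) : ℂ) ((1 : ℝ) : ℂ) := by
      rwa [ofReal_one]
    simpa using this.real_of_complex
  have hg1 : g 1 = 0 := by simp [hg, hf1]
  have hg2 : g 2 = 2 := by simp [hg, hf2]
  obtain ⟨x, hx, hgx⟩ : ∃ x ∈ Set.Ioo (1 : ℝ) 2, g x < 0 := by
    have h1 := (hasDerivAt_iff_tendsto_slope.mp hgd).mono_left
      (nhdsGT_le_nhdsNE 1)
    have h2 : 2 * a * (1 + r - Real.log a) < 0 :=
      mul_neg_of_pos_of_neg (by positivity) (by linarith)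
    obtain ⟨x, hx, hx2⟩ := ((h1.eventually (gt_mem_nhds h2)).and
      (Ioo_mem_nhdsGT one_lt_two)).exists
    refine ⟨x, hx2, ?_⟩
    rw [slope_def_field, hg1, sub_zero] at hx
    by_contra! h
    exact hx.not_ge (div_nonneg h (by linarith [hx2.1]))
  obtain ⟨ρ, hρ, hgρ⟩ := intermediate_value_Icc hx.2.le hgc.continuousOn
    (show (0 : ℝ) ∈ Set.Icc (g x) (g 2) from ⟨hgx.le, by rw [hg2]; norm_num⟩)
  have hρ2 : ρ ≠ 2 := by
    rintro rfl
    rw [hg2] at hgρ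
    norm_num at hgρ
  have hρ1 : 1 < ρ := hx.1.trans_le hρ.1
  refine ⟨ρ, ⟨hρ1, lt_of_le_of_ne hρ.2 hρ2⟩, ?_⟩
  have hfρ : f ρ = 0 := by rw [hreal]; exact_mod_cast hgρ
  have n0 : (ρ : ℂ) ≠ 0 := by exact_mod_cast (by linarith : ρ ≠ 0)
  have n1 : (ρ : ℂ) ≠ 1 := by exact_mod_cast hρ1.ne'
  have n2 : (ρ : ℂ) ≠ 2 := by exact_mod_cast hρ2
  have h := mul_phiK (ΛK := ΛK) hξeq a n0 n1 n2
  rw [(div_eq_zero_iff.mp hfρ).resolve_right hR] at h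
  exact (mul_eq_zero.mp h).resolve_left
    (mul_ne_zero (mul_ne_zero n0 (sub_ne_zero.mpr n1)) (sub_ne_zero.mpr n2))

end Final

lemma one_lt_re_two_div_one_add {w : ℂ} (hw : ‖w‖ < 1) : 1 < (2 / (1 + w)).re := by
  have h0 : 1 + w ≠ 0 := fun h ↦ by
    rw [← neg_eq_of_add_eq_zero_right h, norm_neg, norm_one] at hw
    exact lt_irrefl _ hw
  have h1 : 0 < normSq (1 + w) := normSq_pos.mpr h0
  have h2 : normSq w < 1 := by
    rw [normSq_eq_norm_sq]
    exact pow_lt_one₀ (norm_nonneg _) hw two_ne_zero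
  have h3 : (2 / (1 + w)).re = 2 * (1 + w.re) / normSq (1 + w) := by
    simp [div_re]
  rw [h3, lt_div_iff₀ h1, one_mul]
  rw [normSq_apply] at h2 ⊢
  simp only [add_re, one_re, add_im, one_im]
  linarith

/-- For `K` imaginary quadratic of class number one and `a > max(a*_K, 1)`, where
`a*_K = exp(1 + ξ_K′(0)/ξ_K(0))` and `ξ_K(s) = s(s-1)Λ_K(s)` extended to an entire
function, there is exactly one `ρ_a ∈ (1,2)` with `φ_K(a, ρ_a) = 0`; moreover
`φ_K(a, 2-ρ_a) = 0`, both `ρ_a` and `2-ρ_a` are simple zeros, and every zero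
`s ∉ {0,1,2}` of `φ_K(a,·)` with `Re(s) ≠ 1` belongs to `{ρ_a, 2-ρ_a}`. -/
theorem phiK_off_line_zeros (K : Type*) [Field K] [NumberField K]
    (hdeg : Module.finrank ℚ K = 2)
    (himag : ∀ v : NumberField.InfinitePlace K, v.IsComplex)
    (hclass : NumberField.classNumber K = 1)
    (ΛK : ℂ → ℂ) (hΛ : IsCompletedDedekindZeta K ΛK)
    (ξK : ℂ → ℂ) (hξdiff : Differentiable ℂ ξK)
    (hξeq : ∀ s : ℂ, s ≠ 0 → s ≠ 1 → ξK s = s * (s - 1) * ΛK s)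
    (r : ℝ) (hr : (r : ℂ) = deriv ξK 0 / ξK 0)
    (a : ℝ) (ha : max (Real.exp (1 + r)) 1 < a) :
    ∃ ρ : ℝ, ρ ∈ Set.Ioo (1 : ℝ) 2 ∧ phiK ΛK a ρ = 0 ∧
      (∀ ρ' ∈ Set.Ioo (1 : ℝ) 2, phiK ΛK a ρ' = 0 → ρ' = ρ) ∧
      phiK ΛK a (2 - (ρ : ℂ)) = 0 ∧
      deriv (phiK ΛK a) (ρ : ℂ) ≠ 0 ∧
      deriv (phiK ΛK a) (2 - (ρ : ℂ)) ≠ 0 ∧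
      ∀ s : ℂ, s ∉ ({0, 1, 2} : Set ℂ) → s.re ≠ 1 → phiK ΛK a s = 0 →
        s = (ρ : ℂ) ∨ s = 2 - (ρ : ℂ) := by
  
  have ha1 : 1 < a := (le_max_right _ _).trans_lt ha
  have ha0 : 0 < a := one_pos.trans ha1
  have hac : (a : ℂ) ≠ 0 := ofReal_ne_zero.mpr ha0.ne'
  obtain ⟨ρ, hρ, hφρ⟩ := exists_phiK_eq_zero hΛ hξdiff hξeq hr ha0
    ((Real.lt_log_iff_exp_lt ha0).mpr ((le_max_left _ _).trans_lt ha))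
  obtain ⟨A, hA0, hA⟩ := exists_norm_xi_div_le_of_re_le hdeg himag hclass hΛ hξdiff hξeq
  obtain ⟨B, hB0, hB⟩ := exists_norm_xi_div_le_of_le_re hΛ hξeq
  have hξ0 (s : ℂ) (hs : 1 < s.re) : ξK s ≠ 0 := xi_ne_zero hΛ hξeq hs
  have hle {s : ℂ} (hs : 1 < s.re) : ‖ξK (s - 1)‖ ≤ ‖ξK s‖ :=
    norm_sub_one_le_norm hξdiff (xi_one_sub hΛ hξdiff hξeq) (xi_conj hΛ hξdiff hξeq) hξ0
      hA0 hB0 hA hB hs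
  set H : Set ℂ := {s | 1 < s.re} with hH
  have hHo : IsOpen H := isOpen_lt continuous_const continuous_re
  set G : ℂ → ℂ := fun s ↦ (a : ℂ) ^ (2 - 2 * s) * (ξK (s - 1) / ξK s) with hG
  have hGlt {s : ℂ} (hs : 1 < s.re) : ‖G s‖ < 1 := by
    have h1 : ‖(a : ℂ) ^ (2 - 2 * s)‖ < 1 := by
      rw [norm_cpow_eq_rpow_re_of_pos ha0]
      refine Real.rpow_lt_one_of_one_lt_of_neg ha1 ?_
      simp
      linarith
    have h2 : ‖ξK (s - 1) / ξK s‖ ≤ 1 := by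
      rw [norm_div]
      exact div_le_one_of_le₀ (hle hs) (norm_nonneg _)
    rw [hG, norm_mul]
    exact (mul_le_of_le_one_right (norm_nonneg _) h2).trans_lt h1
  have hG1 {s : ℂ} (hs : 1 < s.re) : 1 + G s ≠ 0 := fun h ↦ by
    have := hGlt hs
    rw [← neg_eq_of_add_eq_zero_right h, norm_neg, norm_one] at this
    exact lt_irrefl _ this
  set U : ℂ → ℂ := fun s ↦ 2 / (1 + G s) with hU
  have hGd {s : ℂ} (hs : 1 < s.re) : DifferentiableAt ℂ G s := by
    have h1 : DifferentiableAt ℂ (fun s : ℂ ↦ (a : ℂ) ^ (2 - 2 * s)) s :=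
      DifferentiableAt.const_cpow (by fun_prop) (Or.inl hac)
    have h2 : DifferentiableAt ℂ (fun s : ℂ ↦ ξK (s - 1)) s := by fun_prop
    exact h1.mul (h2.fun_div (hξdiff s) (hξ0 s hs))
  have hUd {s : ℂ} (hs : 1 < s.re) : DifferentiableAt ℂ U s :=
    (differentiableAt_const _).fun_div ((hGd hs).const_add 1) (hG1 hs)
  have hUmem (s : ℂ) (hs : 1 < s.re) : 1 < (U s).re := one_lt_re_two_div_one_add (hGlt hs)
  set k : ℂ → ℂ := fun s ↦ (a : ℂ) ^ s * ξK s * (1 + G s) / (s * (s - 1) * (s - 2)) with hk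
  have hden {s : ℂ} (hs : 1 < s.re) (h2 : s ≠ 2) : s * (s - 1) * (s - 2) ≠ 0 := by
    refine mul_ne_zero (mul_ne_zero ?_ (sub_ne_zero.mpr ?_)) (sub_ne_zero.mpr h2)
    · rintro rfl
      rw [zero_re] at hs
      linarith
    · rintro rfl
      exact lt_irrefl _ hs
  have hk0 {s : ℂ} (hs : 1 < s.re) (h2 : s ≠ 2) : k s ≠ 0 :=
    div_ne_zero (mul_ne_zero (mul_ne_zero (by simp [cpow_def, hac]) (hξ0 s hs)) (hG1 hs))
      (hden hs h2)
  have hφ {s : ℂ} (hs : 1 < s.re) (h2 : s ≠ 2) : phiK ΛK a s = k s * (s - U s) := by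
    have hd := hden hs h2
    have hξ := hξ0 s hs
    have h1G := hG1 hs
    have hpow : (a : ℂ) ^ s * (a : ℂ) ^ (2 - 2 * s) = (a : ℂ) ^ (2 - s) := by
      rw [← cpow_add _ _ hac]
      ring_nf
    have hGξ : (a : ℂ) ^ s * ξK s * G s = (a : ℂ) ^ (2 - s) * ξK (s - 1) := by
      rw [← hpow]
      simp only [hG]
      field_simp
    have hm := mul_phiK (ΛK := ΛK) hξeq a (left_ne_zero_of_mul (left_ne_zero_of_mul hd))
      (sub_ne_zero.mp (right_ne_zero_of_mul (left_ne_zero_of_mul hd))) h2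
    have hUG : (1 + G s) * U s = 2 := mul_div_cancel₀ _ h1G
    refine mul_left_cancel₀ hd (hm.trans ?_)
    simp only [hk]
    rw [div_mul_eq_mul_div, mul_div_cancel₀ _ hd]
    linear_combination -s * hGξ + (a : ℂ) ^ s * ξK s * hUG
  have hU2 : U 2 ≠ 2 := fun h ↦ by
    have h2re : (1 : ℝ) < (2 : ℂ).re := by norm_num
    have hG2 : G 2 ≠ 0 := by
      refine mul_ne_zero (by simp [cpow_def, hac]) (div_ne_zero ?_ (hξ0 2 h2re))
      rw [show (2 : ℂ) - 1 = 1 by norm_num]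
      exact xi_one_ne_zero hΛ hξdiff hξeq
    rw [hU, div_eq_iff (hG1 h2re)] at h
    exact hG2 (by linear_combination -h / 2)
  have hρre : 1 < (ρ : ℂ).re := hρ.1
  have hρ2 : (ρ : ℂ) ≠ 2 := by exact_mod_cast hρ.2.ne
  have hfix {s : ℂ} (hs : 1 < s.re) (h2 : s ≠ 2) (h : phiK ΛK a s = 0) : U s = s := by
    rw [hφ hs h2] at h
    exact (sub_eq_zero.mp ((mul_eq_zero.mp h).resolve_left (hk0 hs h2))).symm
  have hUρ : U ρ = ρ := hfix hρre hρ2 hφρ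
  have hmain : ¬ (deriv U ρ = 1 ∨ ∃ s : ℂ, 1 < s.re ∧ s ≠ ρ ∧ U s = s) := fun h ↦
    hU2 (eq_self_of_mapsTo_halfPlane (fun s hs ↦ (hUd hs).differentiableWithinAt) hUmem hρ.1 hUρ h
      (by norm_num))
  have hzero {s : ℂ} (hs : 1 < s.re) (h2 : s ≠ 2) (h : phiK ΛK a s = 0) : s = ρ := by
    by_contra hne
    exact hmain (Or.inr ⟨s, hs, hne, hfix hs h2 h⟩)
  have hderiv : deriv (phiK ΛK a) ρ ≠ 0 := by
    have hkd : DifferentiableAt ℂ k ρ := by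
      have h1 : DifferentiableAt ℂ (fun s : ℂ ↦ (a : ℂ) ^ s) ρ :=
        differentiableAt_id.const_cpow (Or.inl hac)
      have h2 : DifferentiableAt ℂ (fun s : ℂ ↦ s * (s - 1) * (s - 2)) ρ := by fun_prop
      exact ((h1.mul (hξdiff _)).mul ((hGd hρre).const_add 1)).fun_div h2 (hden hρre hρ2)
    have hd := hkd.hasDerivAt.mul ((hasDerivAt_id (ρ : ℂ)).sub (hUd hρre).hasDerivAt)
    have heq : phiK ΛK a =ᶠ[nhds (ρ : ℂ)] k * (id - U) := by
      filter_upwards [hHo.mem_nhds hρre, isOpen_ne.mem_nhds hρ2] with s hs h2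
      exact hφ hs h2
    rw [(hd.congr_of_eventuallyEq heq).deriv, Pi.sub_apply, id, hUρ, sub_self, mul_zero, zero_add]
    exact mul_ne_zero (hk0 hρre hρ2) (sub_ne_zero.mpr fun h ↦ hmain (Or.inl h.symm))
  refine ⟨ρ, hρ, hφρ, fun ρ' hρ' h ↦ ?_, ?_, hderiv, ?_, fun s hs hre h ↦ ?_⟩
  · exact_mod_cast hzero (s := ρ') hρ'.1 (by exact_mod_cast hρ'.2.ne) h
  · rw [phiK_two_sub hΛ, hφρ]
  · rw [deriv_phiK_two_sub hΛ]
    exact neg_ne_zero.mpr hderiv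
  · simp only [Set.mem_insert_iff, Set.mem_singleton_iff, not_or] at hs
    rcases hre.lt_or_gt with hlt | hgt
    · right
      rw [← hzero (s := 2 - s) (by simp; linarith) (fun h2 ↦ hs.1 (by linear_combination -h2))
        (by rw [phiK_two_sub hΛ, h])]
      ring
    · exact Or.inl (hzero hgt hs.2.2 h)
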